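/- arXiv:2504.10598 — 4 statements merged into one kernel-verified Lean document; each statement's English description precedes it below -/
import Mathlib

section
/- There is a universal constant c > 0 such that the following holds. For any metric space (X, ρ), any γ > 0, and any integer d with 1 ≤ d ≤ N where N = |C(X, ρ, 2γ)| is the covering number of X at scale 2γ and ⌊N/d⌋ ≥ 2, there exists a class H ⊆ {−1,+1}^X with VC dimension exactly d such that for every randomized online learner and every horizon T ≥ d·log₂(⌊N/d⌋), there exists a sequence (x_1,y_1),…,(x_T,y_T) ∈ X × {−1,+1} with Σ_{t=1}^T E[1[ŷ_t ≠ y_t]] − min_{h∈H} Σ_{t=1}^T sup_{z : ρ(z,x_t) ≤ γ} 1[h(z) ≠ y_t] ≥ c·√(T · d · ln(N/d)). -/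
open Classical in
/-- 0/1 indicator of a proposition, as a real number. -/
noncomputable def ind (P : Prop) : ℝ := if P then 1 else 0

/-- `H` shatters the finite set `S`: every `±1`-labeling of `S` is realized by some `h ∈ H`. -/
def Shatters {X : Type*} (H : Set (X → ℝ)) (S : Finset X) : Prop :=
  ∀ τ : X → Bool, ∃ h ∈ H, ∀ x ∈ S, h x = if τ x then 1 else -1

/-- The VC dimension of `H` equals `d`. -/
def VCDimEq {X : Type*} (H : Set (X → ℝ)) (d : ℕ) : Prop :=
  (∃ S : Finset X, S.card = d ∧ Shatters H S) ∧
  ∀ S : Finset X, Shatters H S → S.card ≤ d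

/-- Expected number of mistakes of a randomized online learner `A` on `(x_t, y_t)_{t<T}`:
`A` maps the history and the current point to its probability of predicting `+1`. -/
noncomputable def expMistakes {X : Type*} (A : List (X × ℝ) → X → ℝ)
    (T : ℕ) (x : ℕ → X) (y : ℕ → ℝ) : ℝ :=
  ∑ t ∈ Finset.range T,
    (1 - y t * (2 * A ((List.range t).map fun i => (x i, y i)) (x t) - 1)) / 2

/-- Cumulative expected number of mistakes of `A` on the rounds `l`, played after `hist`. -/
noncomputable def cumLoss {X : Type*} (A : List (X × ℝ) → X → ℝ) :
    List (X × ℝ) → List (X × ℝ) → ℝ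
  | _, [] => 0
  | hist, q :: l => (1 - q.2 * (2 * A hist q.1 - 1)) / 2 + cumLoss A (hist ++ [q]) l

theorem cumLoss_append {X : Type*} (A : List (X × ℝ) → X → ℝ) (l₁ l₂ hist : List (X × ℝ)) :
    cumLoss A hist (l₁ ++ l₂) = cumLoss A hist l₁ + cumLoss A (hist ++ l₁) l₂ := by
  induction l₁ generalizing hist with
  | nil => simp [cumLoss]
  | cons q l ih => simp [cumLoss, ih, add_assoc]

theorem expMistakes_eq_cumLoss {X : Type*} (A : List (X × ℝ) → X → ℝ) (T : ℕ) (x : ℕ → X)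
    (y : ℕ → ℝ) :
    expMistakes A T x y = cumLoss A [] ((List.range T).map fun i => (x i, y i)) := by
  induction T with
  | zero => simp [expMistakes, cumLoss]
  | succ n ih =>
    rw [List.range_succ, List.map_append, cumLoss_append, ← ih]
    simp [expMistakes, cumLoss, Finset.sum_range_succ]

/-- The mean of `(3 c U ^ 2 - c ^ 3 U ^ 4) / 2`, where `U` is `S` plus a sum of `r` independent
uniform signs. -/
noncomputable def walkPotential (c S r : ℝ) : ℝ :=
  (3 * c * (S ^ 2 + r) - c ^ 3 * (S ^ 4 + 6 * S ^ 2 * r + 3 * r ^ 2 - 2 * r)) / 2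

theorem walkPotential_zero_le_abs {c : ℝ} (hc : 0 ≤ c) (S : ℝ) : walkPotential c S 0 ≤ |S| := by
  have h : |S| - walkPotential c S 0 = |S| * ((c * |S| - 1) ^ 2 * (c * |S| + 2)) / 2 := by
    have h2 : S ^ 2 = |S| ^ 2 := (sq_abs S).symm
    have h4 : S ^ 4 = |S| ^ 4 := by rw [show (4 : ℕ) = 2 * 2 from rfl, pow_mul, pow_mul, h2]
    rw [walkPotential, h2, h4]
    ring
  have : 0 ≤ |S| * ((c * |S| - 1) ^ 2 * (c * |S| + 2)) / 2 := by positivity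
  linarith

theorem exists_labels_walkPotential_le {X : Type*} (A : List (X × ℝ) → X → ℝ) (x : X) (c : ℝ)
    (r : ℕ) (hist : List (X × ℝ)) (S : ℝ) :
    ∃ ys : List ℝ, ys.length = r ∧ (∀ y ∈ ys, y = 1 ∨ y = -1) ∧
      walkPotential c S r / 2 ≤ cumLoss A hist (ys.map fun y => (x, y)) - r / 2
        + walkPotential c (S + ys.sum) 0 / 2 := by
  induction r generalizing hist S with
  | zero => exact ⟨[], by simp [cumLoss]⟩
  | succ r ih =>
    have havg : walkPotential c S (r + 1)
        = (walkPotential c (S + 1) r + walkPotential c (S + -1) r) / 2 := by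
      unfold walkPotential; ring
    have hstep : ∃ y : ℝ, (y = 1 ∨ y = -1) ∧ walkPotential c S (r + 1) / 2 ≤
        (1 - y * (2 * A hist x - 1)) / 2 - 1 / 2 + walkPotential c (S + y) r / 2 := by
      by_contra! hcon
      have h1 := hcon 1 (Or.inl rfl)
      have h2 := hcon (-1) (Or.inr rfl)
      linarith
    obtain ⟨y, hy, hle⟩ := hstep
    obtain ⟨ys, hlen, hys, hih⟩ := ih (hist ++ [(x, y)]) (S + y)
    refine ⟨y :: ys, by simp [hlen], ?_, ?_⟩
    · simpa [hy] using hys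
    · simp only [List.map_cons, cumLoss, List.sum_cons, ← add_assoc]
      push_cast
      linarith

theorem List.sum_map_half_one_sub_mul (ys : List ℝ) (σ : ℝ) :
    (ys.map fun y => (1 - σ * y) / 2).sum = (ys.length - σ * ys.sum) / 2 := by
  induction ys with
  | nil => simp
  | cons y ys ih =>
    simp only [List.map_cons, List.sum_cons, ih, List.length_cons]
    push_cast
    ring

/-- On a constant instance, some labels force regret of order `√n` against the better of the two
constant predictions. -/
theorem exists_labels_regret {X : Type*} (A : List (X × ℝ) → X → ℝ) (x : X) (n : ℕ)
    (hist : List (X × ℝ)) :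
    ∃ (ys : List ℝ) (σ : ℝ), ys.length = n ∧ (∀ y ∈ ys, y = 1 ∨ y = -1) ∧ (σ = 1 ∨ σ = -1) ∧
      √n / 4 ≤ cumLoss A hist (ys.map fun y => (x, y))
        - (ys.map fun y => (1 - σ * y) / 2).sum := by
  obtain ⟨ys, hlen, hys, hle⟩ :=
    exists_labels_walkPotential_le A x (1 / (2 * √n)) n hist 0
  obtain ⟨σ, hσ, habs⟩ : ∃ σ : ℝ, (σ = 1 ∨ σ = -1) ∧ σ * ys.sum = |ys.sum| := by
    rcases abs_cases ys.sum with h | h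
    · exact ⟨1, by simp, by linarith⟩
    · exact ⟨-1, by simp, by linarith⟩
  refine ⟨ys, σ, hlen, hys, hσ, ?_⟩
  rw [List.sum_map_half_one_sub_mul, hlen, habs]
  have h0 := walkPotential_zero_le_abs (c := 1 / (2 * √n)) (by positivity) (0 + ys.sum)
  have h1 : √n / 2 ≤ walkPotential (1 / (2 * √n)) 0 n := by
    rcases Nat.eq_zero_or_pos n with rfl | hn
    · simp [walkPotential]
    · have hs : 0 < √(n : ℝ) := Real.sqrt_pos.mpr (by exact_mod_cast hn)
      have hsq : (n : ℝ) = √n ^ 2 := (Real.sq_sqrt (by positivity)).symm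
      generalize √(n : ℝ) = s at *
      have : walkPotential (1 / (2 * s)) 0 n = 9 / 16 * s + 1 / (8 * s) := by
        rw [walkPotential, hsq]
        field_simp
        ring
      rw [this]
      have : 0 ≤ 1 / (8 * s) := by positivity
      linarith
  rw [zero_add] at h0 hle
  linarith

/-- The functions in `V` that equal `σ` on the whole ball of radius `γ` around `x`. -/
def robustRestrict {X : Type*} [MetricSpace X] (γ : ℝ) (V : Set (X → ℝ)) (x : X) (σ : ℝ) :
    Set (X → ℝ) :=
  {h ∈ V | ∀ z, dist x z ≤ γ → h z = σ}

/-- `V` robustly shatters a complete binary instance tree of depth `n`, i.e. its Littlestone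
dimension with respect to perturbations of size `γ` is at least `n`. -/
def RobustTree {X : Type*} [MetricSpace X] (γ : ℝ) : ℕ → Set (X → ℝ) → Prop
  | 0, V => V.Nonempty
  | n + 1, V => ∃ x, ∀ σ : ℝ, σ = 1 ∨ σ = -1 → RobustTree γ n (robustRestrict γ V x σ)

theorem RobustTree.mono {X : Type*} [MetricSpace X] {γ : ℝ} {n : ℕ} {V W : Set (X → ℝ)}
    (hV : RobustTree γ n V) (hVW : V ⊆ W) : RobustTree γ n W := by
  induction n generalizing V W with
  | zero => exact Set.Nonempty.mono hVW hV
  | succ n ih =>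
    obtain ⟨x, hx⟩ := hV
    exact ⟨x, fun σ hσ => ih (hx σ hσ) fun h hh => ⟨hVW hh.1, hh.2⟩⟩

theorem ind_nonneg (P : Prop) : 0 ≤ ind P := by
  unfold ind; split_ifs <;> norm_num

/-- Against a robust tree of depth `ns.length`, spending `n` rounds on each node for the entries
`n` of `ns` forces regret of order `∑ √n`. -/
theorem RobustTree.exists_regret {X : Type*} [MetricSpace X] {γ : ℝ}
    (A : List (X × ℝ) → X → ℝ) (ns : List ℕ) (V : Set (X → ℝ))
    (hV : RobustTree γ ns.length V) (hist : List (X × ℝ)) :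
    ∃ (l : List (X × ℝ)), ∃ h ∈ V, l.length = ns.sum ∧ (∀ q ∈ l, q.2 = 1 ∨ q.2 = -1) ∧
      (ns.map fun n : ℕ => √(n : ℝ) / 4).sum ≤ cumLoss A hist l
        - (l.map fun q => ind (∃ z : X, dist q.1 z ≤ γ ∧ h z ≠ q.2)).sum := by
  induction ns generalizing V hist with
  | nil =>
    obtain ⟨h, hh⟩ := hV
    exact ⟨[], h, hh, by simp [cumLoss]⟩
  | cons n ns ih =>
    obtain ⟨x, hx⟩ := hV
    obtain ⟨ys, σ, hlen, hys, hσ, hle⟩ := exists_labels_regret A x n hist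
    obtain ⟨l, h, hh, hl, hlab, hih⟩ :=
      ih (robustRestrict γ V x σ) (hx σ hσ) (hist ++ ys.map fun y => (x, y))
    refine ⟨ys.map (fun y => (x, y)) ++ l, h, hh.1, by simp [hlen, hl], ?_, ?_⟩
    · intro q hq
      rcases List.mem_append.mp hq with hq | hq
      · obtain ⟨y, hy, rfl⟩ := List.mem_map.mp hq
        exact hys y hy
      · exact hlab q hq
    · have hcmp : (ys.map fun y => ind (∃ z : X, dist x z ≤ γ ∧ h z ≠ y)).sum
          ≤ (ys.map fun y => (1 - σ * y) / 2).sum := by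
        refine List.sum_le_sum fun y hy => ?_
        by_cases hyσ : y = σ
        · have : ¬ ∃ z : X, dist x z ≤ γ ∧ h z ≠ y := by
            rintro ⟨z, hz, hne⟩
            exact hne ((hh.2 z hz).trans hyσ.symm)
          rw [ind, if_neg this, hyσ]
          rcases hσ with rfl | rfl <;> norm_num
        · have hone : (1 - σ * y) / 2 = 1 := by
            rcases hσ with rfl | rfl <;> rcases hys y hy with rfl | rfl <;>
              first | exact absurd rfl hyσ | norm_num
          rw [hone, ind]
          split_ifs <;> norm_num
      rw [cumLoss_append, List.map_append, List.sum_append, List.map_map]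
      simp only [List.map_cons, List.sum_cons, Function.comp_def]
      linarith

open Classical in
/-- The product threshold function on the `γ`-balls around the points `p (b, i)`: the ball around
`p (b, i)` is labelled `+1` exactly when `i < θ b`. -/
noncomputable def ballThreshold {X : Type*} [MetricSpace X] (γ : ℝ) {d k : ℕ}
    (p : Fin d × Fin k → X) (θ : Fin d → ℕ) (x : X) : ℝ :=
  if ∃ a, dist x (p a) ≤ γ ∧ (a.2 : ℕ) < θ a.1 then 1 else -1

section BallThreshold

variable {X : Type*} [MetricSpace X] {γ : ℝ} {d k : ℕ} {p : Fin d × Fin k → X}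

theorem ballThreshold_eq_one_iff {θ : Fin d → ℕ} {x : X} :
    ballThreshold γ p θ x = 1 ↔ ∃ a, dist x (p a) ≤ γ ∧ (a.2 : ℕ) < θ a.1 := by
  unfold ballThreshold
  split_ifs with h <;> norm_num [h]

theorem ballThreshold_eq_neg_one_iff {θ : Fin d → ℕ} {x : X} :
    ballThreshold γ p θ x = -1 ↔ ¬ ∃ a, dist x (p a) ≤ γ ∧ (a.2 : ℕ) < θ a.1 := by
  unfold ballThreshold
  split_ifs with h <;> norm_num [h]

theorem eq_of_dist_le (hp : Pairwise fun a b => 2 * γ < dist (p a) (p b)) {x : X}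
    {a b : Fin d × Fin k} (ha : dist x (p a) ≤ γ) (hb : dist x (p b) ≤ γ) : a = b := by
  by_contra hab
  have := dist_triangle_left (p a) (p b) x
  linarith [hp hab]

theorem ballThreshold_of_dist_le (hp : Pairwise fun a b => 2 * γ < dist (p a) (p b))
    (θ : Fin d → ℕ) {x : X} {a : Fin d × Fin k} (ha : dist x (p a) ≤ γ) :
    ballThreshold γ p θ x = if (a.2 : ℕ) < θ a.1 then 1 else -1 := by
  split_ifs with h
  · exact ballThreshold_eq_one_iff.mpr ⟨a, ha, h⟩
  · refine ballThreshold_eq_neg_one_iff.mpr ?_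
    rintro ⟨b, hb, hlt⟩
    exact h (eq_of_dist_le hp ha hb ▸ hlt)

theorem vcDimEq_range_ballThreshold (hγ : 0 ≤ γ)
    (hp : Pairwise fun a b => 2 * γ < dist (p a) (p b)) (hk : 0 < k) :
    VCDimEq (Set.range (ballThreshold γ p)) d := by
  classical
  constructor
  · have hinj : Function.Injective fun b : Fin d => p (b, ⟨0, hk⟩) := by
      intro b c hbc
      have := eq_of_dist_le hp (x := p (b, ⟨0, hk⟩)) (a := (b, ⟨0, hk⟩)) (b := (c, ⟨0, hk⟩))
        (by simpa using hγ) (by simpa [show p (b, ⟨0, hk⟩) = p (c, ⟨0, hk⟩) from hbc] using hγ)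
      exact congrArg Prod.fst this
    refine ⟨Finset.univ.image fun b : Fin d => p (b, ⟨0, hk⟩), ?_, ?_⟩
    · rw [Finset.card_image_of_injective _ hinj, Finset.card_univ, Fintype.card_fin]
    · intro τ
      refine ⟨_, ⟨fun b => if τ (p (b, ⟨0, hk⟩)) then 1 else 0, rfl⟩, ?_⟩
      intro x hx
      obtain ⟨b, -, rfl⟩ := Finset.mem_image.mp hx
      rw [ballThreshold_of_dist_le hp _ (a := (b, ⟨0, hk⟩)) (by simpa using hγ)]
      by_cases h : τ (p (b, ⟨0, hk⟩)) <;> simp [h]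
  · intro S hS
    have hnear : ∀ x ∈ S, ∃ a, dist x (p a) ≤ γ := by
      intro x hx
      obtain ⟨_, ⟨θ, rfl⟩, hθ⟩ := hS fun _ => true
      obtain ⟨a, ha, -⟩ := ballThreshold_eq_one_iff.mp (by simpa using hθ x hx)
      exact ⟨a, ha⟩
    rcases S.eq_empty_or_nonempty with rfl | ⟨x₀, hx₀⟩
    · simp
    have : Nonempty (Fin d × Fin k) := ⟨(hnear x₀ hx₀).choose⟩
    choose! f hf using hnear
    have hmono : ∀ x ∈ S, ∀ x' ∈ S, (f x).1 = (f x').1 → (f x).2 ≤ (f x').2 → x = x' := by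
      intro x hx x' hx' hb hi
      by_contra hne
      obtain ⟨_, ⟨θ, rfl⟩, hθ⟩ := hS fun z => decide (z = x')
      have h' := hθ x' hx'
      have h := hθ x hx
      rw [ballThreshold_of_dist_le hp θ (hf x' hx')] at h'
      rw [ballThreshold_of_dist_le hp θ (hf x hx)] at h
      have h1 : ((f x').2 : ℕ) < θ (f x').1 := by
        by_contra hcon
        norm_num [hcon] at h'
      have h2 : ((f x).2 : ℕ) < θ (f x).1 := by
        rw [hb]
        exact lt_of_le_of_lt hi h1
      norm_num [h2, hne] at h
    have hinj : Set.InjOn (fun x => (f x).1) S := by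
      intro x hx x' hx' hb
      rcases le_total (f x).2 (f x').2 with hi | hi
      · exact hmono x hx x' hx' hb hi
      · exact (hmono x' hx' x hx hb.symm hi).symm
    calc S.card = (S.image fun x => (f x).1).card := (Finset.card_image_of_injOn hinj).symm
      _ ≤ Fintype.card (Fin d) := Finset.card_le_univ _
      _ = d := Fintype.card_fin d

/-- Binary search in every block produces a robust tree. -/
theorem robustTree_ballThreshold (hp : Pairwise fun a b => 2 * γ < dist (p a) (p b)) (n : ℕ)
    (lo m : Fin d → ℕ) (hm : ∑ b, m b = n) (hlo : ∀ b, lo b + 2 ^ m b ≤ k + 1) :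
    RobustTree γ n (ballThreshold γ p '' {θ | ∀ b, lo b ≤ θ b ∧ θ b < lo b + 2 ^ m b}) := by
  induction n generalizing lo m with
  | zero =>
    exact Set.Nonempty.image _ ⟨lo, fun b => ⟨le_rfl, Nat.lt_add_of_pos_right (by positivity)⟩⟩
  | succ n ih =>
    obtain ⟨b, hb⟩ : ∃ b, m b ≠ 0 := by
      by_contra! hcon
      simp [hcon] at hm
    obtain ⟨j, hj⟩ := Nat.exists_eq_succ_of_ne_zero hb
    have hpow : 2 ^ m b = 2 ^ j + 2 ^ j := by rw [hj, Nat.succ_eq_add_one, pow_succ]; ring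
    have hpos : 0 < 2 ^ j := by positivity
    have hlob := hlo b
    let i : Fin k := ⟨lo b + 2 ^ j - 1, by omega⟩
    have hsum : ∑ c, Function.update m b j c = n := by
      have h1 := Finset.sum_update_of_mem (Finset.mem_univ b) m j
      have h2 := Finset.add_sum_erase Finset.univ m (Finset.mem_univ b)
      rw [Finset.sdiff_singleton_eq_erase] at h1
      omega
    refine ⟨p (b, i), fun σ hσ => ?_⟩
    obtain ⟨lo', hlo', hin, hlab⟩ : ∃ lo' : ℕ, (lo b ≤ lo') ∧ lo' + 2 ^ j ≤ lo b + 2 ^ m b ∧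
        ∀ t, lo' ≤ t → t < lo' + 2 ^ j → (if (i : ℕ) < t then (1 : ℝ) else -1) = σ := by
      rcases hσ with rfl | rfl
      · exact ⟨lo b + 2 ^ j, by omega, by omega, fun t h1 h2 =>
          if_pos (show lo b + 2 ^ j - 1 < t by omega)⟩
      · exact ⟨lo b, by omega, by omega, fun t h1 h2 =>
          if_neg (show ¬ lo b + 2 ^ j - 1 < t by omega)⟩
    refine (ih (Function.update lo b lo') (Function.update m b j) hsum ?_).mono ?_
    · intro c
      rcases eq_or_ne c b with rfl | hc
      · simp only [Function.update_self]; omega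
      · simpa only [Function.update_of_ne hc] using hlo c
    · rintro _ ⟨θ, hθ, rfl⟩
      have hθb := hθ b
      simp only [Function.update_self] at hθb
      refine ⟨⟨θ, fun c => ?_, rfl⟩, fun z hz => ?_⟩
      · rcases eq_or_ne c b with rfl | hc
        · omega
        · simpa only [Function.update_of_ne hc] using hθ c
      · rw [ballThreshold_of_dist_le hp θ (a := (b, i)) (by rwa [dist_comm])]
        exact hlab _ hθb.1 hθb.2

end BallThreshold

/-- A space without an `r`-cover of fewer than `N` points contains `n ≤ N` points at pairwise
distance more than `r`. -/
theorem exists_separated_finset {X : Type*} [MetricSpace X] {r : ℝ} (hr : 0 ≤ r) {N : ℕ}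
    (hN : ∀ Z : Finset X, (∀ x : X, ∃ z ∈ Z, dist x z ≤ r) → N ≤ Z.card) (n : ℕ) (hn : n ≤ N) :
    ∃ P : Finset X, P.card = n ∧ (P : Set X).Pairwise fun x y => r < dist x y := by
  classical
  induction n with
  | zero => exact ⟨∅, by simp⟩
  | succ n ih =>
    obtain ⟨P, hcard, hP⟩ := ih (by omega)
    obtain ⟨x, hx⟩ : ∃ x : X, ∀ z ∈ P, r < dist x z := by
      by_contra! hcon
      have := hN P hcon
      omega
    have hxP : x ∉ P := by
      intro hmem
      have := hx x hmem
      rw [dist_self] at this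
      linarith
    refine ⟨insert x P, by rw [Finset.card_insert_of_notMem hxP, hcard], ?_⟩
    rw [Finset.coe_insert]
    exact hP.insert fun z hz _ => ⟨hx z hz, dist_comm x z ▸ hx z hz⟩


/-- lower bound for regret against `OPT^γ_pert`, showing that dependence
on the metric entropy (at scale `2γ`) and the VC dimension is unavoidable. -/
theorem stmt1 :
    ∃ c : ℝ, 0 < c ∧
      ∀ (X : Type) [MetricSpace X] (γ : ℝ), 0 < γ →
      ∀ N : ℕ,
        IsLeast {n : ℕ | ∃ Z : Finset X, Z.card = n ∧ ∀ x : X, ∃ z ∈ Z, dist x z ≤ 2 * γ} N →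
      ∀ d : ℕ, 1 ≤ d → d ≤ N → 2 ≤ N / d →
      ∃ H : Set (X → ℝ), (∀ h ∈ H, ∀ x, h x = 1 ∨ h x = -1) ∧ VCDimEq H d ∧
        ∀ A : List (X × ℝ) → X → ℝ, (∀ hist x, A hist x ∈ Set.Icc (0:ℝ) 1) →
        ∀ T : ℕ, (d : ℝ) * Real.logb 2 ((N / d : ℕ) : ℝ) ≤ T →
        ∃ (x : ℕ → X) (y : ℕ → ℝ), (∀ t, y t = 1 ∨ y t = -1) ∧
          c * Real.sqrt (T * d * Real.log ((N : ℝ) / d)) ≤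
            expMistakes A T x y
              - ⨅ h : H, ∑ t ∈ Finset.range T,
                  ind (∃ z : X, dist (x t) z ≤ γ ∧ h.1 z ≠ y t) := by
  refine ⟨1 / 8, by norm_num, ?_⟩
  intro X _ γ hγ N hN d hd hdN hk
  set k := N / d with hkdef
  obtain ⟨P, hPcard, hP⟩ := exists_separated_finset (by positivity : 0 ≤ 2 * γ)
    (fun Z hZ => hN.2 ⟨Z, rfl, hZ⟩) N le_rfl
  have hdk : d * k ≤ P.card := by rw [hPcard]; exact Nat.mul_div_le N d
  let e : Fin d × Fin k → P := fun a => P.equivFin.symm (Fin.castLE hdk (finProdFinEquiv a))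
  have he : Function.Injective e :=
    P.equivFin.symm.injective.comp ((Fin.castLE_injective hdk).comp finProdFinEquiv.injective)
  let p : Fin d × Fin k → X := fun a => e a
  have hp : Pairwise fun a b => 2 * γ < dist (p a) (p b) := fun a b hab =>
    hP (e a).2 (e b).2 fun h => hab (he (Subtype.ext h))
  refine ⟨Set.range (ballThreshold γ p), ?_, vcDimEq_range_ballThreshold hγ.le hp (by omega), ?_⟩
  · rintro _ ⟨θ, rfl⟩ x
    unfold ballThreshold
    split_ifs <;> simp
  intro A _ T hT
  set m := Nat.log 2 k with hmdef
  have hm : 1 ≤ m := Nat.log_pos (by norm_num) hk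
  have hmk : 2 ^ m ≤ k := Nat.pow_log_le_self 2 (by omega)
  set L := d * m with hLdef
  have hL : 0 < L := Nat.mul_pos hd hm
  have hLT : L ≤ T := by
    have h1 : (m : ℝ) ≤ Real.logb 2 (k : ℝ) := by
      rw [Real.le_logb_iff_rpow_le (by norm_num) (by exact_mod_cast (by omega : 0 < k)),
        Real.rpow_natCast]
      exact_mod_cast hmk
    have h2 : ((d * m : ℕ) : ℝ) ≤ T := by
      push_cast
      exact (mul_le_mul_of_nonneg_left h1 (by positivity)).trans hT
    exact_mod_cast h2
  set s := T / L with hsdef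
  have hs : 1 ≤ s := Nat.div_pos hLT hL
  have hdivmod : L * s + T % L = T := Nat.div_add_mod T L
  have hmod : T % L < L := Nat.mod_lt T hL
  have hTs : T ≤ 2 * (L * s) := by nlinarith
  have htree : RobustTree γ L (Set.range (ballThreshold γ p)) :=
    (robustTree_ballThreshold hp L (fun _ => 0) (fun _ => m) (by simp [hLdef])
      fun _ => by omega).mono (Set.image_subset_range _ _)
  obtain ⟨L', hL'⟩ : ∃ L', L = L' + 1 := ⟨L - 1, by omega⟩
  let ns : List ℕ := (s + T % L) :: List.replicate L' s
  have hnsum : ns.sum = T := by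
    simp only [ns, List.sum_cons, List.sum_replicate, smul_eq_mul]
    calc s + T % L + L' * s = (L' + 1) * s + T % L := by ring
      _ = T := by rw [← hL', hdivmod]
  have hnslen : ns.length = L := by simp [ns, hL']
  obtain ⟨l, h, hh, hlen, hlab, hle⟩ :=
    RobustTree.exists_regret A ns (Set.range (ballThreshold γ p)) (hnslen ▸ htree) []
  rw [hnsum] at hlen
  let q₀ : X × ℝ := (p (⟨0, hd⟩, ⟨0, by omega⟩), 1)
  have hq : (List.range T).map (fun i => ((l.getD i q₀).1, (l.getD i q₀).2)) = l := by
    refine List.ext_getElem (by simp [hlen]) fun i h1 h2 => ?_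
    simp [List.getElem?_eq_getElem h2]
  refine ⟨fun i => (l.getD i q₀).1, fun i => (l.getD i q₀).2, fun t => ?_, ?_⟩
  · beta_reduce
    by_cases ht : t < l.length
    · rw [List.getD_eq_getElem _ _ ht]
      exact hlab _ (List.getElem_mem ht)
    · rw [List.getD_eq_default _ _ (by omega)]
      exact Or.inl rfl
  rw [expMistakes_eq_cumLoss, hq]
  have hinf : (⨅ h : Set.range (ballThreshold γ p), ∑ t ∈ Finset.range T,
      ind (∃ z : X, dist (l.getD t q₀).1 z ≤ γ ∧ h.1 z ≠ (l.getD t q₀).2))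
      ≤ (l.map fun q => ind (∃ z : X, dist q.1 z ≤ γ ∧ h z ≠ q.2)).sum := by
    refine (ciInf_le ⟨0, ?_⟩ ⟨h, hh⟩).trans (le_of_eq ?_)
    · rintro _ ⟨g, rfl⟩
      exact Finset.sum_nonneg fun _ _ => ind_nonneg _
    · conv_rhs => rw [← hq]
      rw [List.map_map]
      rfl
  have hsum : L * √(s : ℝ) / 4 ≤ (ns.map fun n : ℕ => √(n : ℝ) / 4).sum := by
    simp only [ns, List.map_cons, List.sum_cons, List.map_replicate, List.sum_replicate,
      nsmul_eq_mul]
    have : √(s : ℝ) ≤ √((s + T % L : ℕ) : ℝ) :=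
      Real.sqrt_le_sqrt (by exact_mod_cast Nat.le_add_right _ _)
    rw [hL']
    push_cast at this ⊢
    rw [hL'] at this
    linarith
  have hlog : (d : ℝ) * Real.log ((N : ℝ) / d) ≤ 2 * L := by
    have hd' : (0 : ℝ) < d := by exact_mod_cast hd
    have hNpos : (0 : ℝ) < N := by exact_mod_cast (by omega : 0 < N)
    have h1 : (N : ℝ) / d ≤ 2 ^ (m + 1) := by
      rw [div_le_iff₀ hd']
      have ha : N < d * (k + 1) := Nat.lt_mul_div_succ N hd
      have hb : k < 2 ^ (m + 1) := Nat.lt_pow_succ_log_self (by norm_num) k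
      have hc : N ≤ 2 ^ (m + 1) * d := by nlinarith
      exact_mod_cast hc
    have h2 : Real.log ((N : ℝ) / d) ≤ (m + 1) * Real.log 2 := by
      refine (Real.log_le_log (by positivity) h1).trans (le_of_eq ?_)
      rw [Real.log_pow]
      push_cast
      rfl
    have h3 : Real.log 2 ≤ 1 := by linarith [Real.log_two_lt_d9]
    have hm' : (1 : ℝ) ≤ m := by exact_mod_cast hm
    have h4 : Real.log ((N : ℝ) / d) ≤ 2 * m := by nlinarith
    rw [hLdef]
    push_cast
    nlinarith
  have hsqrt : √(T * d * Real.log ((N : ℝ) / d)) ≤ 2 * (L * √(s : ℝ)) := by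
    refine Real.sqrt_le_iff.mpr ⟨by positivity, ?_⟩
    rw [mul_pow, mul_pow, Real.sq_sqrt (by positivity)]
    have hTs' : (T : ℝ) ≤ 2 * (L * s) := by exact_mod_cast hTs
    have h1 := mul_le_mul_of_nonneg_left hlog (Nat.cast_nonneg (α := ℝ) T)
    have h2 := mul_le_mul_of_nonneg_right hTs' (by positivity : (0 : ℝ) ≤ 2 * L)
    nlinarith
  linarith
end

section
/- There is a universal constant c > 0 such that the following holds. Let X = [0,1] ⊂ ℝ, let γ ∈ (0, 1/2), let L ∈ (0,∞), and let N = |C([0,1], |·|, √(32/π)·γ/L)|. For any integer d with 1 ≤ d ≤ N and ⌊N/d⌋ ≥ 2, there exists a class F ⊆ [−1,+1]^{[0,1]} that is L-Lipschitz relative to |·| with pseudo-dimension exactly d, such that for every randomized online learner and every horizon T ≥ d·log₂(⌊N/d⌋), there exists a sequence (x_1,y_1),…,(x_T,y_T) ∈ [0,1] × {−1,+1} with Σ_{t=1}^T E[1[ŷ_t ≠ y_t]] − min_{f∈F} Σ_{t=1}^T 1[ y_t·f(x_t) ≤ γ ] ≥ c·√(T · d · ln(N/d)). -/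
/-- `F` pseudo-shatters the finite set `S` with thresholds `r`: every sign pattern is
realized by `sign (f x - r x)` (with `sign t = +1` iff `t > 0`) for some `f ∈ F`. -/
def PseudoShatters {X : Type*} (F : Set (X → ℝ)) (S : Finset X) (r : X → ℝ) : Prop :=
  ∀ τ : X → Bool, ∃ f ∈ F, ∀ x ∈ S, if τ x then r x < f x else f x ≤ r x

/-- The pseudo-dimension of `F` equals `d`. -/
def PseudoDimEq {X : Type*} (F : Set (X → ℝ)) (d : ℕ) : Prop :=
  (∃ (S : Finset X) (r : X → ℝ), S.card = d ∧ PseudoShatters F S r) ∧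
  ∀ (S : Finset X) (r : X → ℝ), PseudoShatters F S r → S.card ≤ d

section OnlineLowerBound

variable {X : Type*}

/-- Expected number of mistakes of `A` on the examples `l` when started with history `h`. -/
noncomputable def loss (A : List (X × ℝ) → X → ℝ) : List (X × ℝ) → List (X × ℝ) → ℝ
  | _, [] => 0
  | h, e :: l => (1 - e.2 * (2 * A h e.1 - 1)) / 2 + loss A (h ++ [e]) l

/-- Number of examples in `l` that `f` fails to classify with margin `γ`. -/
noncomputable def marginErrors (γ : ℝ) (f : X → ℝ) (l : List (X × ℝ)) : ℝ :=
  (l.map fun e => ind (e.2 * f e.1 ≤ γ)).sum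

/-- All labels in `l` are `1` or `-1`. -/
def SignLabelled (l : List (X × ℝ)) : Prop := ∀ e ∈ l, e.2 = 1 ∨ e.2 = -1

/-- `F` shatters, with margin `γ`, a complete binary tree of the given depth. -/
def TreeShatters (γ : ℝ) : ℕ → Set (X → ℝ) → Prop
  | 0, F => F.Nonempty
  | D + 1, F => ∃ x, ∀ y : ℝ, y = 1 ∨ y = -1 → TreeShatters γ D {f ∈ F | γ < y * f x}

lemma TreeShatters.mono {γ : ℝ} {D : ℕ} {F G : Set (X → ℝ)} (hF : TreeShatters γ D F)
    (h : F ⊆ G) : TreeShatters γ D G := by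
  induction D generalizing F G with
  | zero => exact Set.Nonempty.mono h hF
  | succ D ih =>
    obtain ⟨x, hx⟩ := hF
    exact ⟨x, fun y hy => ih (hx y hy) fun f hf => ⟨h hf.1, hf.2⟩⟩

lemma loss_append (A : List (X × ℝ) → X → ℝ) (h l₁ l₂ : List (X × ℝ)) :
    loss A h (l₁ ++ l₂) = loss A h l₁ + loss A (h ++ l₁) l₂ := by
  induction l₁ generalizing h with
  | nil => simp [loss]
  | cons e l ih => simp [loss, ih, add_assoc]

lemma marginErrors_append (γ : ℝ) (f : X → ℝ) (l₁ l₂ : List (X × ℝ)) :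
    marginErrors γ f (l₁ ++ l₂) = marginErrors γ f l₁ + marginErrors γ f l₂ := by
  simp [marginErrors]

lemma SignLabelled.append {l₁ l₂ : List (X × ℝ)} (h₁ : SignLabelled l₁) (h₂ : SignLabelled l₂) :
    SignLabelled (l₁ ++ l₂) := fun e he =>
  (List.mem_append.1 he).elim (h₁ e) (h₂ e)

lemma sq_sub_fourth_le_abs {a : ℝ} (ha : 0 < a) (s : ℝ) :
    a * s ^ 2 - a ^ 3 / 4 * s ^ 4 ≤ |s| := by
  have h1 : s ^ 2 = |s| ^ 2 := (sq_abs s).symm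
  have h2 : s ^ 4 = |s| ^ 4 := by rw [show (4 : ℕ) = 2 * 2 from rfl, pow_mul, pow_mul, h1]
  rw [h1, h2]
  have hu : 0 ≤ |s| := abs_nonneg s
  generalize |s| = w at hu
  have h3 : 0 ≤ a * w := by positivity
  have h4 : 0 ≤ 1 - a * w + (a * w) ^ 3 / 4 := by
    nlinarith [mul_nonneg h3 (sq_nonneg (a * w - 1)), sq_nonneg (a * w - 1)]
  nlinarith [mul_nonneg hu h4]

/-- An adversary replaying one point forces the label sum to deviate as a random walk does. -/
lemma exists_labels_walk (A : List (X × ℝ) → X → ℝ) (x : X) {a : ℝ} (ha : 0 < a) (n : ℕ)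
    (h : List (X × ℝ)) (s : ℝ) :
    ∃ l : List (X × ℝ), l.length = n ∧ SignLabelled l ∧ (∀ e ∈ l, e.1 = x) ∧
      a * (s ^ 2 + n) - a ^ 3 / 4 * (s ^ 4 + 6 * s ^ 2 * n + 3 * n ^ 2 - 2 * n) ≤
        2 * loss A h l - n + |s + (l.map Prod.snd).sum| := by
  induction n generalizing h s with
  | zero =>
    refine ⟨[], rfl, by simp [SignLabelled], by simp, ?_⟩
    simpa [loss] using sq_sub_fourth_le_abs ha s
  | succ n ih =>
    have step : ∀ y : ℝ, y = 1 ∨ y = -1 →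
        a * (s ^ 2 + (n + 1 : ℕ)) - a ^ 3 / 4 * (s ^ 4 + 6 * s ^ 2 * (n + 1 : ℕ)
            + 3 * (n + 1 : ℕ) ^ 2 - 2 * (n + 1 : ℕ)) ≤
          (a * ((s + y) ^ 2 + n)
            - a ^ 3 / 4 * ((s + y) ^ 4 + 6 * (s + y) ^ 2 * n + 3 * n ^ 2 - 2 * n))
            - y * (2 * A h x - 1) →
        ∃ l : List (X × ℝ), l.length = n + 1 ∧ SignLabelled l ∧ (∀ e ∈ l, e.1 = x) ∧
          a * (s ^ 2 + (n + 1 : ℕ)) - a ^ 3 / 4 * (s ^ 4 + 6 * s ^ 2 * (n + 1 : ℕ)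
            + 3 * (n + 1 : ℕ) ^ 2 - 2 * (n + 1 : ℕ)) ≤
          2 * loss A h l - (n + 1 : ℕ) + |s + (l.map Prod.snd).sum| := by
      intro y hy hle
      obtain ⟨l, hl, hs, hx, hb⟩ := ih (h ++ [(x, y)]) (s + y)
      refine ⟨(x, y) :: l, by simp [hl], ?_, ?_, hle.trans ?_⟩
      · intro e he
        rcases List.mem_cons.1 he with rfl | he
        · exact hy
        · exact hs e he
      · intro e he
        rcases List.mem_cons.1 he with rfl | he
        · rfl
        · exact hx e he
      · simp only [loss, List.map_cons, List.sum_cons, ← add_assoc]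
        push_cast
        linarith
    by_contra hcon
    have h1 := fun hle => hcon (step 1 (Or.inl rfl) hle)
    have h2 := fun hle => hcon (step (-1) (Or.inr rfl) hle)
    rw [imp_false, not_le] at h1 h2
    push_cast at h1 h2
    nlinarith [h1, h2]

lemma marginErrors_le_of_margin {γ : ℝ} {f : X → ℝ} {x : X} {y₀ : ℝ} (hy : y₀ = 1 ∨ y₀ = -1)
    (hf : γ < y₀ * f x) (l : List (X × ℝ)) (hl : SignLabelled l) (hx : ∀ e ∈ l, e.1 = x) :
    2 * marginErrors γ f l ≤ l.length - y₀ * (l.map Prod.snd).sum := by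
  induction l with
  | nil => simp [marginErrors]
  | cons e l ih =>
    have ih' := ih (fun e he => hl e (by simp [he])) (fun e he => hx e (by simp [he]))
    have h1 : 2 * ind (e.2 * f e.1 ≤ γ) ≤ 1 - y₀ * e.2 := by
      rw [hx e (by simp)]
      unfold ind
      split_ifs with hc
      · rcases hy with rfl | rfl <;> rcases hl e (by simp) with h | h <;> rw [h] at hc ⊢ <;> linarith
      · rcases hy with rfl | rfl <;> rcases hl e (by simp) with h | h <;> rw [h] <;> norm_num
    simp only [marginErrors, List.map_cons, List.sum_cons, List.length_cons] at ih' ⊢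
    push_cast
    linarith

lemma exists_labels_regret_s5 (A : List (X × ℝ) → X → ℝ) (γ : ℝ) (x : X) {n : ℕ} (hn : 1 ≤ n)
    (h : List (X × ℝ)) :
    ∃ l : List (X × ℝ), l.length = n ∧ SignLabelled l ∧ ∃ y₀ : ℝ, (y₀ = 1 ∨ y₀ = -1) ∧
      ∀ f : X → ℝ, γ < y₀ * f x → √n / 8 ≤ loss A h l - marginErrors γ f l := by
  have hn' : (0 : ℝ) < n := by exact_mod_cast hn
  have hq : 0 < √(n : ℝ) := Real.sqrt_pos.2 hn'
  obtain ⟨l, hl, hs, hx, hb⟩ := exists_labels_walk A x (inv_pos.2 hq) n h 0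
  have hval : √(n : ℝ) / 4 ≤ (√(n : ℝ))⁻¹ * ((0 : ℝ) ^ 2 + n) - (√(n : ℝ))⁻¹ ^ 3 / 4 *
      ((0 : ℝ) ^ 4 + 6 * 0 ^ 2 * n + 3 * n ^ 2 - 2 * n) := by
    have e : (n : ℝ) = √(n : ℝ) ^ 2 := (Real.sq_sqrt hn'.le).symm
    generalize √(n : ℝ) = q at hq e
    rw [e]
    have : q⁻¹ * ((0 : ℝ) ^ 2 + q ^ 2) - q⁻¹ ^ 3 / 4 *
      ((0 : ℝ) ^ 4 + 6 * 0 ^ 2 * q ^ 2 + 3 * (q ^ 2) ^ 2 - 2 * q ^ 2) = q / 4 + q⁻¹ / 2 := by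
      field_simp
      ring
    rw [this]
    have := inv_pos.2 hq
    linarith
  have hsum : ∃ y₀ : ℝ, (y₀ = 1 ∨ y₀ = -1) ∧
      |0 + (l.map Prod.snd).sum| = y₀ * (l.map Prod.snd).sum := by
    rw [zero_add]
    rcases abs_choice (l.map Prod.snd).sum with e | e
    · exact ⟨1, Or.inl rfl, by rw [e, one_mul]⟩
    · exact ⟨-1, Or.inr rfl, by rw [e, neg_one_mul]⟩
  obtain ⟨y₀, hy₀, he⟩ := hsum
  refine ⟨l, hl, hs, y₀, hy₀, fun f hf => ?_⟩
  have := marginErrors_le_of_margin hy₀ hf l hs hx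
  rw [he] at hb
  rw [hl] at this
  linarith

lemma TreeShatters.exists_regret {γ : ℝ} {D : ℕ} {F : Set (X → ℝ)} (hF : TreeShatters γ D F)
    (A : List (X × ℝ) → X → ℝ) {n : ℕ} (hn : 1 ≤ n) (h : List (X × ℝ)) :
    ∃ l : List (X × ℝ), l.length = D * n ∧ SignLabelled l ∧
      ∃ f ∈ F, D * (√n / 8) ≤ loss A h l - marginErrors γ f l := by
  induction D generalizing F h with
  | zero =>
    obtain ⟨f, hf⟩ := hF
    exact ⟨[], by simp, by simp [SignLabelled], f, hf, by simp [loss, marginErrors]⟩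
  | succ D ih =>
    obtain ⟨x, hx⟩ := hF
    obtain ⟨l₁, hl₁, hs₁, y₀, hy₀, hr₁⟩ := exists_labels_regret_s5 A γ x hn h
    obtain ⟨l₂, hl₂, hs₂, f, hf, hr₂⟩ := ih (hx y₀ hy₀) (h ++ l₁)
    refine ⟨l₁ ++ l₂, by rw [List.length_append, hl₁, hl₂]; ring, hs₁.append hs₂, f, hf.1, ?_⟩
    have := hr₁ f hf.2
    rw [loss_append, marginErrors_append]
    push_cast
    linarith

lemma loss_nonneg {A : List (X × ℝ) → X → ℝ} (hA : ∀ h x, A h x ∈ Set.Icc (0 : ℝ) 1)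
    (h l : List (X × ℝ)) (hl : SignLabelled l) : 0 ≤ loss A h l := by
  induction l generalizing h with
  | nil => simp [loss]
  | cons e l ih =>
    have h1 := ih (h ++ [e]) (fun e he => hl e (by simp [he]))
    have h2 := hA h e.1
    rw [loss]
    rcases hl e (by simp) with he | he <;> rw [he] <;> linarith [h2.1, h2.2]

lemma TreeShatters.exists_regret_horizon {γ : ℝ} {D : ℕ} {F : Set (X → ℝ)}
    (hF : TreeShatters γ D F) (hD : 1 ≤ D)
    (hm : ∀ f ∈ F, ∃ x, ∃ y : ℝ, (y = 1 ∨ y = -1) ∧ γ < y * f x)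
    {A : List (X × ℝ) → X → ℝ} (hA : ∀ h x, A h x ∈ Set.Icc (0 : ℝ) 1) {T : ℕ} (hT : D ≤ T) :
    ∃ l : List (X × ℝ), l.length = T ∧ SignLabelled l ∧
      ∃ f ∈ F, √(T * D) / 16 ≤ loss A [] l - marginErrors γ f l := by
  have hn : 1 ≤ T / D := (Nat.one_le_div_iff hD).2 hT
  obtain ⟨l, hl, hs, f, hf, hr⟩ := hF.exists_regret A hn []
  obtain ⟨x, y, hy, hxy⟩ := hm f hf
  have hs' : SignLabelled (List.replicate (T % D) (x, y)) := by
    intro e he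
    rw [List.eq_of_mem_replicate he]
    exact hy
  refine ⟨l ++ List.replicate (T % D) (x, y), ?_, hs.append hs', f, hf, ?_⟩
  · rw [List.length_append, hl, List.length_replicate, Nat.div_add_mod]
  have h1 := loss_nonneg hA ([] ++ l) _ hs'
  have h2 : marginErrors γ f (List.replicate (T % D) (x, y)) = 0 := by
    simp [marginErrors, ind, not_le.2 hxy]
  rw [loss_append, marginErrors_append, h2]
  have h3 : √((T : ℝ) * D) ≤ 2 * (D * √((T / D : ℕ) : ℝ)) := by
    apply Real.sqrt_le_iff.2
    refine ⟨by positivity, ?_⟩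
    have h4 : T ≤ 2 * (D * (T / D)) := by
      have := Nat.div_add_mod T D
      have h5 := Nat.mod_lt T hD
      have h6 : D * 1 ≤ D * (T / D) := Nat.mul_le_mul_left D hn
      omega
    have h4' : (T : ℝ) ≤ 2 * (D * (T / D : ℕ)) := by exact_mod_cast h4
    have h5 : (2 * (D * √((T / D : ℕ) : ℝ))) ^ 2 = 4 * D * (D * (T / D : ℕ)) := by
      rw [mul_pow, mul_pow, Real.sq_sqrt (Nat.cast_nonneg _)]
      ring
    have hD0 : (0 : ℝ) ≤ D := Nat.cast_nonneg _
    have hT0 : (0 : ℝ) ≤ T := Nat.cast_nonneg _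
    rw [h5]
    nlinarith [mul_le_mul_of_nonneg_right h4' hD0, mul_nonneg hD0 hT0]
  linarith

lemma loss_eq_sum (A : List (X × ℝ) → X → ℝ) (h l : List (X × ℝ)) (e₀ : X × ℝ) :
    loss A h l = ∑ t ∈ Finset.range l.length,
      (1 - (l.getD t e₀).2 * (2 * A (h ++ l.take t) (l.getD t e₀).1 - 1)) / 2 := by
  induction l generalizing h with
  | nil => simp [loss]
  | cons e l ih => simp [loss, ih, Finset.sum_range_succ', add_comm]

lemma marginErrors_eq_sum (γ : ℝ) (f : X → ℝ) (l : List (X × ℝ)) (e₀ : X × ℝ) :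
    marginErrors γ f l = ∑ t ∈ Finset.range l.length,
      ind ((l.getD t e₀).2 * f (l.getD t e₀).1 ≤ γ) := by
  induction l with
  | nil => simp [marginErrors]
  | cons e l ih =>
    simp only [marginErrors] at ih
    simp [marginErrors, ih, Finset.sum_range_succ', add_comm]

lemma expMistakes_getD (A : List (X × ℝ) → X → ℝ) (l : List (X × ℝ)) (e₀ : X × ℝ) :
    expMistakes A l.length (fun t => (l.getD t e₀).1) (fun t => (l.getD t e₀).2) =
      loss A [] l := by
  rw [loss_eq_sum A [] l e₀, expMistakes]
  refine Finset.sum_congr rfl fun t ht => ?_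
  have : ((List.range t).map fun i => ((l.getD i e₀).1, (l.getD i e₀).2)) = l.take t := by
    apply List.ext_getElem
    · simp [(Finset.mem_range.1 ht).le]
    · intro i h1 h2
      have : i < l.length := by simp at h2; omega
      simp [this]
  rw [this, List.nil_append]

end OnlineLowerBound

section TentClass

/-- The index of the grid point `j / n` nearest to `x`. -/
noncomputable def nearestIndex (n : ℕ) (x : Set.Icc (0 : ℝ) 1) : ℕ := ⌊(x : ℝ) * n + 1 / 2⌋₊

/-- The tent function of height `v` and slope `K * n` around the nearest grid point. -/
noncomputable def tent (n : ℕ) (K v : ℝ) (x : Set.Icc (0 : ℝ) 1) : ℝ :=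
  max 0 (v - K * |(x : ℝ) * n - nearestIndex n x|)

/-- Sign of the `j`-th grid point when block `b = j / M < d` has threshold `θ b`. -/
def thresholdSign (d M : ℕ) (θ : ℕ → ℕ) (j : ℕ) : ℝ :=
  if j < d * M then (if θ (j / M) ≤ j % M then 1 else -1) else 0

/-- Tents at the grid points, signed by `thresholdSign`. -/
noncomputable def signedTents (n d M : ℕ) (K v : ℝ) (θ : ℕ → ℕ) (x : Set.Icc (0 : ℝ) 1) : ℝ :=
  thresholdSign d M θ (nearestIndex n x) * tent n K v x

/-- The grid point `j / n`. -/
noncomputable def gridPoint (n j : ℕ) : Set.Icc (0 : ℝ) 1 :=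
  Set.projIcc 0 1 zero_le_one ((j : ℝ) / n)

variable {n d M : ℕ} {K v : ℝ}

lemma abs_thresholdSign_le (d M : ℕ) (θ : ℕ → ℕ) (j : ℕ) : |thresholdSign d M θ j| ≤ 1 := by
  unfold thresholdSign
  split_ifs <;> simp

lemma abs_sub_nearestIndex_le (n : ℕ) (x : Set.Icc (0 : ℝ) 1) :
    |(x : ℝ) * n - nearestIndex n x| ≤ 1 / 2 := by
  have h0 : 0 ≤ (x : ℝ) * n + 1 / 2 := by have := x.2.1; positivity
  have h1 := Nat.floor_le h0
  have h2 := Nat.lt_floor_add_one ((x : ℝ) * n + 1 / 2)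
  unfold nearestIndex
  rw [abs_le]
  constructor <;> linarith

lemma tent_nonneg (n : ℕ) (K v : ℝ) (x : Set.Icc (0 : ℝ) 1) : 0 ≤ tent n K v x := le_max_left _ _

lemma tent_le (hK : 0 ≤ K) (hv : 0 ≤ v) (x : Set.Icc (0 : ℝ) 1) : tent n K v x ≤ v :=
  max_le hv (by have := mul_nonneg hK (abs_nonneg ((x : ℝ) * n - nearestIndex n x)); linarith)

lemma tent_le_of_half (hK : 0 ≤ K) (hvK : 2 * v ≤ K) (x : Set.Icc (0 : ℝ) 1) :
    tent n K v x ≤ K * (1 / 2 - |(x : ℝ) * n - nearestIndex n x|) := by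
  have h := abs_sub_nearestIndex_le n x
  exact max_le (mul_nonneg hK (by linarith)) (by linarith)

lemma abs_signedTents_le (n d M : ℕ) (K v : ℝ) (θ : ℕ → ℕ) (x : Set.Icc (0 : ℝ) 1) :
    |signedTents n d M K v θ x| ≤ tent n K v x := by
  rw [signedTents, abs_mul, abs_of_nonneg (tent_nonneg n K v x)]
  exact mul_le_of_le_one_left (tent_nonneg n K v x) (abs_thresholdSign_le d M θ _)

lemma abs_signedTents_sub_le (hK : 0 ≤ K) (hvK : 2 * v ≤ K) (θ : ℕ → ℕ)
    (x x' : Set.Icc (0 : ℝ) 1) :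
    |signedTents n d M K v θ x - signedTents n d M K v θ x'| ≤
      K * |(x : ℝ) * n - (x' : ℝ) * n| := by
  by_cases hi : nearestIndex n x = nearestIndex n x'
  · rw [signedTents, signedTents, ← hi, ← mul_sub, abs_mul]
    refine (mul_le_of_le_one_left (abs_nonneg _) (abs_thresholdSign_le d M θ _)).trans ?_
    rw [tent, tent, ← hi]
    refine (abs_max_sub_max_le_max _ _ _ _).trans ?_
    rw [sub_self, abs_zero, max_eq_right (abs_nonneg _)]
    have : v - K * |(x : ℝ) * n - nearestIndex n x| - (v - K * |(x' : ℝ) * n - nearestIndex n x|) =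
      K * (|(x' : ℝ) * n - nearestIndex n x| - |(x : ℝ) * n - nearestIndex n x|) := by ring
    rw [this, abs_mul, abs_of_nonneg hK]
    refine mul_le_mul_of_nonneg_left ((abs_abs_sub_abs_le _ _).trans ?_) hK
    rw [abs_sub_comm]
    simp
  · have h1 := abs_signedTents_le n d M K v θ x
    have h2 := abs_signedTents_le n d M K v θ x'
    have h3 := tent_le_of_half (n := n) hK hvK x
    have h4 := tent_le_of_half (n := n) hK hvK x'
    have h5 : 1 ≤ |(nearestIndex n x : ℝ) - nearestIndex n x'| := by
      have : 1 ≤ |(nearestIndex n x : ℤ) - nearestIndex n x'| :=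
        Int.one_le_abs (sub_ne_zero.2 (by exact_mod_cast hi))
      exact_mod_cast this
    have h6 : |(nearestIndex n x : ℝ) - nearestIndex n x'| ≤
        |(x : ℝ) * n - nearestIndex n x| + |(x : ℝ) * n - (x' : ℝ) * n| +
          |(x' : ℝ) * n - nearestIndex n x'| := by
      have e1 := abs_le.1 (le_refl |(x : ℝ) * n - nearestIndex n x|)
      have e2 := abs_le.1 (le_refl |(x : ℝ) * n - (x' : ℝ) * n|)
      have e3 := abs_le.1 (le_refl |(x' : ℝ) * n - nearestIndex n x'|)
      rw [abs_le]
      constructor <;> linarith [e1.1, e1.2, e2.1, e2.2, e3.1, e3.2]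
    have h7 := abs_sub (signedTents n d M K v θ x) (signedTents n d M K v θ x')
    have h8 : K * (1 - |(x : ℝ) * n - nearestIndex n x| - |(x' : ℝ) * n - nearestIndex n x'|) ≤
        K * |(x : ℝ) * n - (x' : ℝ) * n| := mul_le_mul_of_nonneg_left (by linarith) hK
    linarith

lemma coe_gridPoint {j : ℕ} (hj : j ≤ n) : (gridPoint n j : ℝ) = (j : ℝ) / n := by
  have h : (j : ℝ) / n ∈ Set.Icc (0 : ℝ) 1 :=
    ⟨by positivity, div_le_one_of_le₀ (by exact_mod_cast hj) (Nat.cast_nonneg _)⟩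
  rw [gridPoint, Set.projIcc_of_mem _ h]

lemma gridPoint_mul (hn : 1 ≤ n) {j : ℕ} (hj : j ≤ n) : (gridPoint n j : ℝ) * n = j := by
  have : (n : ℝ) ≠ 0 := by positivity
  rw [coe_gridPoint hj]
  field_simp

lemma nearestIndex_gridPoint (hn : 1 ≤ n) {j : ℕ} (hj : j ≤ n) :
    nearestIndex n (gridPoint n j) = j := by
  rw [nearestIndex, gridPoint_mul hn hj, Nat.floor_eq_iff (by positivity)]
  constructor <;> linarith

lemma signedTents_gridPoint (hn : 1 ≤ n) (hv : 0 ≤ v) (θ : ℕ → ℕ) {j : ℕ} (hj : j ≤ n) :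
    signedTents n d M K v θ (gridPoint n j) = thresholdSign d M θ j * v := by
  simp [signedTents, tent, nearestIndex_gridPoint hn hj, gridPoint_mul hn hj, hv]

lemma thresholdSign_block {k a : ℕ} (hk : k < d) (ha : a < M) (θ : ℕ → ℕ) :
    thresholdSign d M θ (k * M + a) = if θ k ≤ a then 1 else -1 := by
  have h1 : k * M + a < d * M := by nlinarith
  have h2 : (k * M + a) / M = k := by
    rw [mul_comm, Nat.mul_add_div (by omega), Nat.div_eq_of_lt ha, add_zero]
  have h3 : (k * M + a) % M = a := by
    rw [mul_comm, Nat.mul_add_mod, Nat.mod_eq_of_lt ha]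
  rw [thresholdSign, if_pos h1, h2, h3]

lemma card_le_of_pseudoShatters_signedTents (S : Finset (Set.Icc (0 : ℝ) 1))
    (r : Set.Icc (0 : ℝ) 1 → ℝ)
    (hS : PseudoShatters (Set.range (signedTents n d M K v)) S r) : S.card ≤ d := by
  classical
  obtain ⟨_, ⟨θ₁, rfl⟩, h₁⟩ := hS fun _ => true
  obtain ⟨_, ⟨θ₀, rfl⟩, h₀⟩ := hS fun _ => false
  simp only [if_true, Bool.false_eq_true, if_false] at h₁ h₀
  have lower : ∀ x ∈ S, -tent n K v x ≤ r x := fun x hx =>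
    (abs_le.1 (abs_signedTents_le n d M K v θ₀ x)).1.trans (h₀ x hx)
  have upper : ∀ x ∈ S, r x < tent n K v x := fun x hx =>
    (h₁ x hx).trans_le (abs_le.1 (abs_signedTents_le n d M K v θ₁ x)).2
  have hlt : ∀ x ∈ S, nearestIndex n x < d * M := by
    intro x hx
    by_contra hcon
    have e1 := h₁ x hx
    have e0 := h₀ x hx
    simp only [signedTents, thresholdSign, if_neg hcon, zero_mul] at e1 e0
    linarith
  have key : ∀ x ∈ S, ∀ x' ∈ S, x ≠ x' → nearestIndex n x / M = nearestIndex n x' / M →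
      nearestIndex n x % M ≤ nearestIndex n x' % M → False := by
    intro x hx x' hx' hne hdiv hmod
    obtain ⟨_, ⟨θ, rfl⟩, hθ⟩ := hS fun z => decide (z = x)
    have e1 := hθ x hx
    have e2 := hθ x' hx'
    simp only [decide_true, if_true] at e1
    simp only [hne.symm, decide_false, Bool.false_eq_true, if_false] at e2
    rw [signedTents, thresholdSign, if_pos (hlt x hx)] at e1
    rw [signedTents, thresholdSign, if_pos (hlt x' hx'), ← hdiv] at e2
    have l1 := lower x hx
    have u2 := upper x' hx'
    split_ifs at e1 e2 with c1 c2 c2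
    · linarith
    · exact c2 (c1.trans hmod)
    · linarith
    · linarith
  have : S.card ≤ (Finset.range d).card := by
    refine Finset.card_le_card_of_injOn (fun x => nearestIndex n x / M) ?_ ?_
    · intro x hx
      exact Finset.mem_coe.2 (Finset.mem_range.2 (Nat.div_lt_of_lt_mul (by
        rw [mul_comm]; exact hlt x hx)))
    · intro x hx x' hx' he
      by_contra hne
      rcases le_total (nearestIndex n x % M) (nearestIndex n x' % M) with h | h
      · exact key x hx x' hx' hne he h
      · exact key x' hx' x hx (Ne.symm hne) he.symm h
  simpa using this

lemma pseudoDimEq_signedTents (hn : 1 ≤ n) (hM : 1 ≤ M) (hd : d * M ≤ n + 1) (hv : 0 < v) :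
    PseudoDimEq (Set.range (signedTents n d M K v)) d := by
  classical
  refine ⟨⟨(Finset.range d).image fun k => gridPoint n (k * M), fun _ => 0, ?_, ?_⟩,
    fun S r => card_le_of_pseudoShatters_signedTents S r⟩
  · have hle : ∀ k < d, k * M ≤ n := fun k hk => by nlinarith
    rw [Finset.card_image_of_injOn, Finset.card_range]
    intro k hk k' hk' he
    have := congrArg (nearestIndex n) he
    simp only at this
    rw [nearestIndex_gridPoint hn (hle k (by simpa using hk)),
      nearestIndex_gridPoint hn (hle k' (by simpa using hk'))] at this
    exact Nat.eq_of_mul_eq_mul_right hM this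
  · intro τ
    refine ⟨_, ⟨fun k => if τ (gridPoint n (k * M)) then 0 else 1, rfl⟩, ?_⟩
    intro x hx
    obtain ⟨k, hk, rfl⟩ := Finset.mem_image.1 hx
    have hk := Finset.mem_range.1 hk
    have hle : k * M ≤ n := by nlinarith
    have hs := thresholdSign_block hk (show 0 < M from hM)
      (fun k => if τ (gridPoint n (k * M)) then 0 else 1)
    rw [add_zero] at hs
    rw [signedTents_gridPoint hn hv.le _ hle, hs]
    by_cases h : τ (gridPoint n (k * M)) = true
    · simp [h, hv]
    · simp [h, hv.le]

lemma treeShatters_signedTents {γ : ℝ} {m : ℕ} (hn : 1 ≤ n) (hd : d * M ≤ n + 1) (hm : 2 ^ m ≤ M)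
    (hγ : γ < v) (hv : 0 < v) (k : ℕ) (hk : k ≤ d) (θ₀ : ℕ → ℕ) :
    TreeShatters γ (k * m)
      (signedTents n d M K v '' {θ | ∀ j, k ≤ j → θ j = θ₀ j}) := by
  induction k generalizing θ₀ with
  | zero =>
    rw [zero_mul]
    exact ⟨_, θ₀, fun _ _ => rfl, rfl⟩
  | succ k ih =>
    have inner : ∀ i lo : ℕ, lo + 2 ^ i ≤ 2 ^ m → TreeShatters γ (k * m + i)
        (signedTents n d M K v ''
          {θ | (∀ j, k + 1 ≤ j → θ j = θ₀ j) ∧ lo ≤ θ k ∧ θ k < lo + 2 ^ i}) := by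
      intro i
      induction i with
      | zero =>
        intro lo _
        refine (ih (by omega) (Function.update θ₀ k lo)).mono (Set.image_mono fun θ hθ => ?_)
        have hk' : θ k = lo := by simpa using hθ k le_rfl
        refine ⟨fun j hj => ?_, by omega, by simp [hk']⟩
        rw [hθ j (by omega), Function.update_of_ne (by omega)]
      | succ i ihi =>
        intro lo hlo
        have hpos : 0 < 2 ^ i := by positivity
        have hpow : 2 ^ (i + 1) = 2 ^ i + 2 ^ i := by ring
        have ha : lo + 2 ^ i - 1 < M := by omega
        have hj : k * M + (lo + 2 ^ i - 1) ≤ n := by nlinarith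
        refine ⟨gridPoint n (k * M + (lo + 2 ^ i - 1)), fun y hy => ?_⟩
        rcases hy with rfl | rfl
        · refine (ihi lo (by omega)).mono ?_
          rintro _ ⟨θ, ⟨h1, h2, h3⟩, rfl⟩
          refine ⟨⟨θ, ⟨h1, h2, by omega⟩, rfl⟩, ?_⟩
          rw [signedTents_gridPoint hn hv.le _ hj, thresholdSign_block (by omega) ha,
            if_pos (by omega)]
          linarith
        · refine (ihi (lo + 2 ^ i) (by omega)).mono ?_
          rintro _ ⟨θ, ⟨h1, h2, h3⟩, rfl⟩
          refine ⟨⟨θ, ⟨h1, by omega, by omega⟩, rfl⟩, ?_⟩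
          rw [signedTents_gridPoint hn hv.le _ hj, thresholdSign_block (by omega) ha,
            if_neg (by omega)]
          linarith
    rw [add_mul, one_mul]
    exact (inner m 0 (by omega)).mono (Set.image_mono fun θ hθ => hθ.1)

/-- A minimal cover of `[0, 1]` by `n + 1` balls of radius `r` forces `2 * r * n < 1`. -/
lemma two_mul_radius_mul_lt_one {r : ℝ} {n : ℕ} (hn : 1 ≤ n)
    (h : n + 1 ∈ lowerBounds {c : ℕ | ∃ Z : Finset (Set.Icc (0 : ℝ) 1), Z.card = c ∧
      ∀ x : Set.Icc (0 : ℝ) 1, ∃ z ∈ Z, dist x z ≤ r}) : 2 * r * n < 1 := by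
  classical
  by_contra! hcon
  have hn0 : (0 : ℝ) < n := by exact_mod_cast hn
  let Z : Finset (Set.Icc (0 : ℝ) 1) :=
    (Finset.range n).image fun j : ℕ => Set.projIcc 0 1 zero_le_one (((j : ℝ) + 1 / 2) / n)
  have hZ : n + 1 ≤ Z.card := by
    refine h ⟨Z, rfl, fun x => ?_⟩
    have hj : ∃ j : ℕ, j < n ∧ (j : ℝ) ≤ x * n ∧ (x : ℝ) * n ≤ j + 1 := by
      have hx0 : 0 ≤ (x : ℝ) * n := mul_nonneg x.2.1 hn0.le
      by_cases hx : ⌊(x : ℝ) * n⌋₊ < n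
      · exact ⟨_, hx, Nat.floor_le hx0, (Nat.lt_floor_add_one _).le⟩
      · have h1 : (n : ℝ) ≤ x * n := (Nat.le_floor_iff hx0).1 (not_lt.1 hx)
        have h2 : (x : ℝ) * n ≤ n := mul_le_of_le_one_left hn0.le x.2.2
        have h3 : ((n - 1 : ℕ) : ℝ) = n - 1 := by push_cast [hn]; ring
        exact ⟨n - 1, by omega, by rw [h3]; linarith, by rw [h3]; linarith⟩
    obtain ⟨j, hjn, hj1, hj2⟩ := hj
    refine ⟨_, Finset.mem_image.2 ⟨j, Finset.mem_range.2 hjn, rfl⟩, ?_⟩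
    have hjn' : (j : ℝ) + 1 ≤ n := by exact_mod_cast hjn
    have hmem : ((j : ℝ) + 1 / 2) / n ∈ Set.Icc (0 : ℝ) 1 :=
      ⟨by positivity, (div_le_one hn0).2 (by linarith)⟩
    rw [Set.projIcc_of_mem _ hmem, Subtype.dist_eq, Real.dist_eq]
    have hr : 1 / 2 ≤ r * n := by linarith
    have e : (x : ℝ) - ((j : ℝ) + 1 / 2) / n = (x * n - (j + 1 / 2)) / n := by field_simp
    rw [e, abs_div, abs_of_pos hn0, div_le_iff₀ hn0]
    refine le_trans (abs_le.2 ⟨?_, ?_⟩) hr <;> linarith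
  have : Z.card ≤ n := Finset.card_image_le.trans (Finset.card_range n).le
  omega

lemma log_div_le_four_mul_log {N d : ℕ} (hd : 1 ≤ d) (h : 2 ≤ N / d) :
    Real.log ((N : ℝ) / d) ≤ 4 * Nat.log 2 (N / d) := by
  have hd0 : (0 : ℝ) < d := by exact_mod_cast hd
  set M := N / d with hM
  set m := Nat.log 2 M with hm
  have h1 : N < (M + 1) * d := by
    have := Nat.lt_mul_div_succ N (show 0 < d from hd)
    rw [mul_comm]
    exact this
  have h2 : M < 2 ^ (m + 1) := Nat.lt_pow_succ_log_self (by norm_num) M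
  have hm1 : 1 ≤ m := Nat.log_pos (by norm_num) h
  have hNpos : 0 < N := by
    rcases Nat.eq_zero_or_pos N with h0 | h0
    · simp [h0] at hM; omega
    · exact h0
  have h3 : (N : ℝ) / d ≤ 2 ^ (m + 1) := by
    rw [div_le_iff₀ hd0]
    have : N ≤ 2 ^ (m + 1) * d := h1.le.trans (Nat.mul_le_mul_right d h2)
    exact_mod_cast this
  have h4 : Real.log ((N : ℝ) / d) ≤ Real.log (2 ^ (m + 1)) :=
    Real.log_le_log (by positivity) h3
  rw [Real.log_pow] at h4
  have h5 : Real.log 2 ≤ 1 := by linarith [Real.log_two_lt_d9]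
  have h6 : ((m + 1 : ℕ) : ℝ) * Real.log 2 ≤ (m + 1 : ℕ) :=
    mul_le_of_le_one_right (Nat.cast_nonneg _) h5
  have h7 : (1 : ℝ) ≤ m := by exact_mod_cast hm1
  push_cast at h4 h6
  linarith

end TentClass

/-- lower bound for regret against the margin benchmark `OPT^γ_margin`
for `L`-Lipschitz classes on the domain `[0,1]` (realized as the subtype `↥(Set.Icc 0 1)`,
whose metric is the restriction of `|·|`). -/
theorem stmt5 :
    ∃ c : ℝ, 0 < c ∧
      ∀ γ L : ℝ, 0 < γ → γ < 1/2 → 0 < L →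
      ∀ N : ℕ,
        IsLeast {n : ℕ | ∃ Z : Finset ↥(Set.Icc (0:ℝ) 1), Z.card = n ∧
          ∀ x : ↥(Set.Icc (0:ℝ) 1), ∃ z ∈ Z, dist x z ≤ Real.sqrt (32 / Real.pi) * γ / L} N →
      ∀ d : ℕ, 1 ≤ d → d ≤ N → 2 ≤ N / d →
      ∃ F : Set (↥(Set.Icc (0:ℝ) 1) → ℝ),
        (∀ f ∈ F, ∀ x, f x ∈ Set.Icc (-1:ℝ) 1) ∧
        (∀ f ∈ F, ∀ x x', |f x - f x'| ≤ L * dist x x') ∧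
        PseudoDimEq F d ∧
        ∀ A : List (↥(Set.Icc (0:ℝ) 1) × ℝ) → ↥(Set.Icc (0:ℝ) 1) → ℝ,
          (∀ hist x, A hist x ∈ Set.Icc (0:ℝ) 1) →
        ∀ T : ℕ, (d : ℝ) * Real.logb 2 ((N / d : ℕ) : ℝ) ≤ T →
        ∃ (x : ℕ → ↥(Set.Icc (0:ℝ) 1)) (y : ℕ → ℝ), (∀ t, y t = 1 ∨ y t = -1) ∧
          c * Real.sqrt (T * d * Real.log ((N : ℝ) / d)) ≤
            expMistakes A T x y
              - ⨅ f : F, ∑ t ∈ Finset.range T, ind (y t * f.1 (x t) ≤ γ) := by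
  refine ⟨1 / 32, by norm_num, ?_⟩
  intro γ L hγ hγ2 hL N hN d hd hdN hM
  obtain ⟨n, rfl⟩ : ∃ n, N = n + 1 := ⟨N - 1, by
    have : N ≠ 0 := by omega
    omega⟩
  have hdM : d * ((n + 1) / d) ≤ n + 1 := Nat.mul_div_le _ _
  have hn : 1 ≤ n := by nlinarith
  have hlog : (1 : ℕ) ≤ Nat.log 2 ((n + 1) / d) := Nat.log_pos (by norm_num) hM
  have hlogc := log_div_le_four_mul_log hd hM
  generalize (n + 1) / d = M at hM hdM hlog hlogc
  have hn0 : (0 : ℝ) < n := by exact_mod_cast hn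
  have hcov := two_mul_radius_mul_lt_one hn hN.2
  have hsqrt : 2 ≤ √(32 / Real.pi) := by
    apply Real.le_sqrt_of_sq_le
    rw [le_div_iff₀ Real.pi_pos]
    linarith [Real.pi_lt_four]
  have hK : 2 * (2 * γ) ≤ L / n := by
    rw [le_div_iff₀ hn0]
    have e : 2 * (√(32 / Real.pi) * γ / L) * n = (2 * √(32 / Real.pi) * γ * n) / L := by ring
    rw [e, div_lt_one hL] at hcov
    have := mul_le_mul_of_nonneg_right hsqrt (mul_pos hγ hn0).le
    nlinarith
  have hK0 : 0 ≤ L / n := by positivity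
  refine ⟨Set.range (signedTents n d M (L / n) (2 * γ)), ?_, ?_,
    pseudoDimEq_signedTents hn (by omega) hdM (by linarith), ?_⟩
  · rintro _ ⟨θ, rfl⟩ x
    have h1 := abs_signedTents_le n d M (L / n) (2 * γ) θ x
    have h2 := tent_le (n := n) (v := 2 * γ) hK0 (by linarith) x
    exact abs_le.1 (by linarith)
  · rintro _ ⟨θ, rfl⟩ x x'
    refine (abs_signedTents_sub_le hK0 hK θ x x').trans (le_of_eq ?_)
    rw [← sub_mul, abs_mul, abs_of_pos hn0, Subtype.dist_eq, Real.dist_eq]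
    field_simp
  intro A hA T hT
  set m := Nat.log 2 M with hm
  have hpow : 2 ^ m ≤ M := Nat.pow_log_le_self 2 (by omega)
  have hDT : d * m ≤ T := by
    have h1 : (m : ℝ) ≤ Real.logb 2 M := by
      rw [Real.le_logb_iff_rpow_le (by norm_num) (by positivity), Real.rpow_natCast]
      exact_mod_cast hpow
    have h2 := (mul_le_mul_of_nonneg_left h1 (Nat.cast_nonneg d)).trans hT
    exact_mod_cast h2
  have hshat : TreeShatters γ (d * m) (Set.range (signedTents n d M (L / n) (2 * γ))) :=
    (treeShatters_signedTents hn hdM hpow (by linarith) (by linarith) d le_rfl 0).mono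
      (Set.image_subset_range _ _)
  have hmargin : ∀ f ∈ Set.range (signedTents n d M (L / n) (2 * γ)), ∃ x, ∃ y : ℝ,
      (y = 1 ∨ y = -1) ∧ γ < y * f x := by
    rintro _ ⟨θ, rfl⟩
    have hs := thresholdSign_block (show 0 < d from hd) (show 0 < M by omega) θ
    rw [zero_mul, zero_add] at hs
    refine ⟨gridPoint n 0, if θ 0 ≤ 0 then 1 else -1, by split_ifs <;> simp, ?_⟩
    rw [signedTents_gridPoint hn (by linarith) θ (Nat.zero_le n), hs]
    split_ifs <;> linarith
  obtain ⟨l, rfl, hs, f, hf, hr⟩ :=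
    hshat.exists_regret_horizon (Nat.mul_pos hd hlog) hmargin hA hDT
  refine ⟨fun t => (l.getD t (gridPoint n 0, 1)).1, fun t => (l.getD t (gridPoint n 0, 1)).2,
    fun t => ?_, ?_⟩
  · by_cases ht : t < l.length
    · simpa [ht] using hs _ (List.getElem_mem ht)
    · simp [not_lt.1 ht]
  rw [expMistakes_getD]
  have hinf : (⨅ f : Set.range (signedTents n d M (L / n) (2 * γ)),
      ∑ t ∈ Finset.range l.length, ind ((l.getD t (gridPoint n 0, 1)).2 *
        f.1 (l.getD t (gridPoint n 0, 1)).1 ≤ γ)) ≤ marginErrors γ f l := by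
    rw [marginErrors_eq_sum γ f l (gridPoint n 0, 1)]
    refine ciInf_le ⟨0, ?_⟩ (⟨f, hf⟩ : Set.range (signedTents n d M (L / n) (2 * γ)))
    rintro _ ⟨g, rfl⟩
    refine Finset.sum_nonneg fun t _ => ?_
    unfold ind
    split_ifs <;> norm_num
  have hfin : √((l.length : ℝ) * d * Real.log (((n + 1 : ℕ) : ℝ) / d)) ≤
      2 * √((l.length : ℝ) * (d * m : ℕ)) := by
    rw [show (2 : ℝ) = √4 by rw [show (4 : ℝ) = 2 ^ 2 by norm_num]; simp,
      ← Real.sqrt_mul (by norm_num)]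
    apply Real.sqrt_le_sqrt
    have := mul_le_mul_of_nonneg_left hlogc
      (show (0 : ℝ) ≤ (l.length : ℝ) * d by positivity)
    push_cast at this ⊢
    linarith
  linarith
end

section
/- There is a universal constant c > 0 such that the following holds. Let ‖·‖ be any norm on ℝ^d with dual norm ‖w‖* = sup{⟨w,x⟩ : ‖x‖ ≤ 1}, let X ⊆ ℝ^d with B = sup_{x∈X} ‖x‖ < ∞, and let γ > 0. There exists a randomized online learner such that for every horizon T and every sequence (x_1,y_1),…,(x_T,y_T) ∈ X × {−1,+1}, Σ_{t=1}^T E[1[ŷ_t ≠ y_t]] − min_{w ∈ ℝ^d, ‖w‖* = 1} Σ_{t=1}^T 1[ y_t·⟨w, x_t⟩ ≤ γ ] ≤ c·√(T · d · ln(1 + 2B/γ)). -/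
open scoped RealInnerProductSpace

/-- Jensen's inequality for the normalised log-partition function. -/
lemma log_mean_exp_div_mono {ι : Type*} [Fintype ι] [Nonempty ι] (L : ι → ℝ) {a b : ℝ}
    (hb : 0 < b) (hab : b ≤ a) :
    Real.log ((∑ i, Real.exp (-(b * L i))) / Fintype.card ι) / b ≤
      Real.log ((∑ i, Real.exp (-(a * L i))) / Fintype.card ι) / a := by
  have ha : 0 < a := hb.trans_le hab
  have hN : (0 : ℝ) < Fintype.card ι := by exact_mod_cast Fintype.card_pos
  have hpos (r : ℝ) : 0 < (∑ i, Real.exp (-(r * L i))) / Fintype.card ι :=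
    div_pos (Finset.sum_pos (fun i _ => Real.exp_pos _) Finset.univ_nonempty) hN
  have key := Real.rpow_arith_mean_le_arith_mean_rpow Finset.univ
    (fun _ : ι => (1 : ℝ) / Fintype.card ι) (fun i => Real.exp (-(b * L i)))
    (fun _ _ => by positivity) (by simp) (fun _ _ => (Real.exp_pos _).le)
    (p := a / b) ((one_le_div hb).2 hab)
  have h1 (i : ι) : Real.exp (-(b * L i)) ^ (a / b) = Real.exp (-(a * L i)) := by
    rw [← Real.exp_mul]
    congr 1
    field_simp
  simp only [h1, one_div_mul_eq_div, ← Finset.sum_div] at key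
  have h2 := Real.log_le_log (Real.rpow_pos_of_pos (hpos b) _) key
  rw [Real.log_rpow (hpos b)] at h2
  rw [div_le_div_iff₀ hb ha]
  rw [div_mul_eq_mul_div, div_le_iff₀ hb] at h2
  linarith

lemma exp_neg_le_one_sub_add_sq {z : ℝ} (hz : 0 ≤ z) : Real.exp (-z) ≤ 1 - z + z ^ 2 := by
  have h1 : 1 + z ≤ Real.exp z := by linarith [Real.add_one_le_exp z]
  rw [Real.exp_neg]
  refine (inv_anti₀ (by linarith) h1).trans ?_
  rw [inv_le_iff_one_le_mul₀ (by linarith)]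
  nlinarith [pow_nonneg hz 3]

/-- One round of exponential weights decreases the log-partition function by about the
expected loss. -/
lemma log_mean_exp_step {ι : Type*} [Fintype ι] [Nonempty ι] (L l : ι → ℝ) {η : ℝ}
    (hη : 0 < η) (hl : ∀ i, l i ∈ Set.Icc (0 : ℝ) 1) :
    (∑ i, Real.exp (-(η * L i)) * l i) / (∑ i, Real.exp (-(η * L i))) +
      Real.log ((∑ i, Real.exp (-(η * (L i + l i)))) / Fintype.card ι) / η ≤
    Real.log ((∑ i, Real.exp (-(η * L i))) / Fintype.card ι) / η + η := by
  have hN : (0 : ℝ) < Fintype.card ι := by exact_mod_cast Fintype.card_pos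
  have hpos (M : ι → ℝ) : 0 < ∑ i, Real.exp (-(η * M i)) :=
    Finset.sum_pos (fun i _ => Real.exp_pos _) Finset.univ_nonempty
  have hW := hpos L
  have hW' := hpos fun i => L i + l i
  set W := ∑ i, Real.exp (-(η * L i)) with hWdef
  set m := (∑ i, Real.exp (-(η * L i)) * l i) / W with hm
  have hmW : ∑ i, Real.exp (-(η * L i)) * l i = m * W := by rw [hm]; field_simp
  have h1 : ∑ i, Real.exp (-(η * (L i + l i))) ≤ W * (1 - η * m + η ^ 2) := by
    calc ∑ i, Real.exp (-(η * (L i + l i)))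
        ≤ ∑ i, (Real.exp (-(η * L i)) - η * (Real.exp (-(η * L i)) * l i)
            + η ^ 2 * Real.exp (-(η * L i))) := by
          refine Finset.sum_le_sum fun i _ => ?_
          have h0 := (hl i).1
          have h2 := exp_neg_le_one_sub_add_sq (mul_nonneg hη.le h0)
          have h3 : (η * l i) ^ 2 ≤ η ^ 2 := by
            rw [mul_pow]
            exact mul_le_of_le_one_right (sq_nonneg η) (pow_le_one₀ h0 (hl i).2)
          have h4 : Real.exp (-(η * (L i + l i))) =
              Real.exp (-(η * L i)) * Real.exp (-(η * l i)) := by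
            rw [← Real.exp_add]; congr 1; ring
          rw [h4]
          nlinarith [mul_le_mul_of_nonneg_left (h2.trans (add_le_add_right h3 _))
            (Real.exp_pos (-(η * L i))).le]
      _ = W * (1 - η * m + η ^ 2) := by
          rw [Finset.sum_add_distrib, Finset.sum_sub_distrib, ← Finset.mul_sum,
            ← Finset.mul_sum, hmW, ← hWdef]
          ring
  have h2 : ∑ i, Real.exp (-(η * (L i + l i))) ≤ W * Real.exp (-(η * m) + η ^ 2) := by
    refine h1.trans (mul_le_mul_of_nonneg_left ?_ hW.le)
    linarith [Real.add_one_le_exp (-(η * m) + η ^ 2)]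
  have h3 := Real.log_le_log hW' h2
  rw [Real.log_mul hW.ne' (Real.exp_pos _).ne', Real.log_exp] at h3
  rw [Real.log_div hW'.ne' hN.ne', Real.log_div hW.ne' hN.ne']
  have h4 : Real.log W - Real.log (Fintype.card ι) - η * m + η * η ≥
      Real.log (∑ i, Real.exp (-(η * (L i + l i)))) - Real.log (Fintype.card ι) := by
    nlinarith
  have h5 := div_le_div_of_nonneg_right h4 hη.le
  have h6 : (Real.log W - Real.log (Fintype.card ι) - η * m + η * η) / η =
      (Real.log W - Real.log (Fintype.card ι)) / η - m + η := by field_simp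
  linarith

lemma sum_inv_sqrt_le (T : ℕ) :
    ∑ t ∈ Finset.range T, 1 / Real.sqrt (t + 1) ≤ 2 * Real.sqrt T := by
  induction T with
  | zero => simp
  | succ n ih =>
    rw [Finset.sum_range_succ]
    push_cast
    have h0 := Real.sqrt_nonneg (n : ℝ)
    have h1 : 0 < Real.sqrt ((n : ℝ) + 1) := Real.sqrt_pos.2 (by positivity)
    have h2 := Real.sq_sqrt (Nat.cast_nonneg (α := ℝ) n)
    have h3 := Real.sq_sqrt (by positivity : (0 : ℝ) ≤ (n : ℝ) + 1)
    have h4 : 1 / Real.sqrt ((n : ℝ) + 1) ≤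
        2 * Real.sqrt ((n : ℝ) + 1) - 2 * Real.sqrt n := by
      rw [div_le_iff₀ h1]
      nlinarith [sq_nonneg (Real.sqrt ((n : ℝ) + 1) - Real.sqrt n)]
    linarith

/-- Regret of exponential weights with step sizes `a / √(t + 1)`. -/
lemma exp_weights_regret {ι : Type*} [Fintype ι] [Nonempty ι] (l : ℕ → ι → ℝ)
    (hl : ∀ t i, l t i ∈ Set.Icc (0 : ℝ) 1) {a : ℝ} (ha : 0 < a)
    (hcard : Real.log (Fintype.card ι) ≤ a ^ 2) (T : ℕ) (j : ι) :
    ∑ t ∈ Finset.range T,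
      (∑ i, Real.exp (-(a / Real.sqrt (t + 1) * ∑ s ∈ Finset.range t, l s i)) * l t i) /
        (∑ i, Real.exp (-(a / Real.sqrt (t + 1) * ∑ s ∈ Finset.range t, l s i))) ≤
      ∑ t ∈ Finset.range T, l t j + 4 * (a * Real.sqrt T) := by
  have hN : (0 : ℝ) < Fintype.card ι := by exact_mod_cast Fintype.card_pos
  have hη (t : ℕ) : 0 < a / Real.sqrt (t + 1) := div_pos ha (Real.sqrt_pos.2 (by positivity))
  have hpot (t : ℕ) : ∑ t ∈ Finset.range t,
      (∑ i, Real.exp (-(a / Real.sqrt (t + 1) * ∑ s ∈ Finset.range t, l s i)) * l t i) /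
        (∑ i, Real.exp (-(a / Real.sqrt (t + 1) * ∑ s ∈ Finset.range t, l s i))) +
      Real.log ((∑ i, Real.exp (-(a / Real.sqrt (t + 1) * ∑ s ∈ Finset.range t, l s i))) /
        Fintype.card ι) / (a / Real.sqrt (t + 1)) ≤
      ∑ t ∈ Finset.range t, a / Real.sqrt (t + 1) := by
    induction t with
    | zero => simp
    | succ t ih =>
      rw [Finset.sum_range_succ, Finset.sum_range_succ (fun t : ℕ => a / Real.sqrt (t + 1))]
      have h1 := log_mean_exp_step (fun i => ∑ s ∈ Finset.range t, l s i) (l t) (hη t) (hl t)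
      have h2 : a / Real.sqrt ((t + 1 : ℕ) + 1) ≤ a / Real.sqrt (t + 1) := by
        refine div_le_div_of_nonneg_left ha.le (Real.sqrt_pos.2 (by positivity))
          (Real.sqrt_le_sqrt ?_)
        push_cast
        linarith
      have h3 := log_mean_exp_div_mono (fun i => ∑ s ∈ Finset.range (t + 1), l s i)
        (hη (t + 1)) h2
      simp only [← Finset.sum_range_succ (fun s => l s _)] at h1
      linarith
  rcases Nat.eq_zero_or_pos T with rfl | hT
  · simp
  have h1 := hpot T
  set S := ∑ i, Real.exp (-(a / Real.sqrt (T + 1) * ∑ s ∈ Finset.range T, l s i)) with hS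
  have h2 : Real.exp (-(a / Real.sqrt (T + 1) * ∑ s ∈ Finset.range T, l s j)) ≤ S :=
    Finset.single_le_sum
      (f := fun i => Real.exp (-(a / Real.sqrt (T + 1) * ∑ s ∈ Finset.range T, l s i)))
      (fun i _ => (Real.exp_pos _).le) (Finset.mem_univ j)
  have h3 := Real.log_le_log (Real.exp_pos _) h2
  rw [Real.log_exp] at h3
  have hSpos : 0 < S := (Real.exp_pos _).trans_le h2
  rw [Real.log_div hSpos.ne' hN.ne'] at h1
  have h4 : -(∑ s ∈ Finset.range T, l s j) - 2 * (a * Real.sqrt T) ≤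
      (Real.log S - Real.log (Fintype.card ι)) / (a / Real.sqrt (T + 1)) := by
    rw [le_div_iff₀ (hη T)]
    have h5 : a * a ≤ 2 * (a * Real.sqrt T) * (a / Real.sqrt (T + 1)) := by
      have hs : 0 < Real.sqrt ((T : ℝ) + 1) := Real.sqrt_pos.2 (by positivity)
      have h6 : Real.sqrt ((T : ℝ) + 1) ≤ 2 * Real.sqrt T := by
        rw [Real.sqrt_le_iff]
        have hT' : (1 : ℝ) ≤ T := by exact_mod_cast hT
        refine ⟨by positivity, ?_⟩
        rw [mul_pow, Real.sq_sqrt (by positivity)]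
        linarith
      rw [mul_div_assoc', le_div_iff₀ hs]
      nlinarith [mul_le_mul_of_nonneg_left h6 (mul_pos ha ha).le]
    nlinarith
  have h7 : ∑ t ∈ Finset.range T, a / Real.sqrt ((t : ℝ) + 1) ≤ 2 * (a * Real.sqrt T) := by
    have := mul_le_mul_of_nonneg_left (sum_inv_sqrt_le T) ha.le
    rw [Finset.mul_sum] at this
    simp only [mul_one_div] at this
    linarith
  linarith

open MeasureTheory Module Pointwise in
/-- Volume bound for the size of a separated subset of the unit ball of a seminorm. -/
lemma Seminorm.card_le_of_separated {E : Type*} [NormedAddCommGroup E] [NormedSpace ℝ E]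
    [FiniteDimensional ℝ E] (p : Seminorm ℝ E) (hp : Continuous p) {C : ℝ}
    (hC : ∀ x, ‖x‖ ≤ C * p x) {ε : ℝ} (hε : 0 < ε) (s : Finset E) (hs : ∀ v ∈ s, p v ≤ 1)
    (hsep : ∀ v ∈ s, ∀ w ∈ s, v ≠ w → ε ≤ p (v - w)) :
    (s.card : ℝ) ≤ (1 + 2 / ε) ^ finrank ℝ E := by
  borelize E
  let μ : Measure E := Measure.addHaar
  have hopen (v : E) (r : ℝ) : IsOpen (p.ball v r) := by
    have : p.ball v r = {w | p (w - v) < r} := by ext; simp [Seminorm.mem_ball]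
    rw [this]
    exact isOpen_lt (hp.comp (continuous_id.sub continuous_const)) continuous_const
  have hscale (v : E) {r : ℝ} (hr : 0 < r) :
      μ (p.ball v r) = ENNReal.ofReal (r ^ finrank ℝ E) * μ (p.ball 0 1) := by
    have h1 : p.ball v r = v +ᵥ (r • p.ball 0 1) := by
      rw [Seminorm.smul_ball_zero hr.ne', Seminorm.vadd_ball]
      simp [abs_of_pos hr]
    rw [h1, measure_vadd, Measure.addHaar_smul_of_nonneg _ hr.le]
  have hpos : μ (p.ball 0 1) ≠ 0 :=
    ((hopen 0 1).measure_pos μ ⟨0, by simp⟩).ne'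
  have hfin : μ (p.ball 0 1) ≠ ⊤ := by
    refine ((measure_mono fun w hw => ?_).trans_lt
      (measure_closedBall_lt_top (μ := μ) (x := 0) (r := |C|))).ne
    rw [Seminorm.mem_ball_zero] at hw
    rw [mem_closedBall_zero_iff]
    have h1 := apply_nonneg p w
    nlinarith [hC w, le_abs_self C, abs_nonneg C]
  have hdisj : Set.Pairwise (s : Set E) (Function.onFun Disjoint fun v => p.ball v (ε / 2)) := by
    intro v hv w hw hvw
    refine Set.disjoint_left.2 fun z hz hz' => ?_
    rw [Seminorm.mem_ball] at hz hz'
    have h1 := hsep v hv w hw hvw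
    have h2 := map_add_le_add p (v - z) (z - w)
    rw [sub_add_sub_cancel, map_sub_rev p v z] at h2
    linarith
  have hsub : (⋃ v ∈ s, p.ball v (ε / 2)) ⊆ p.ball 0 (1 + ε / 2) := by
    refine Set.iUnion₂_subset fun v hv z hz => ?_
    rw [Seminorm.mem_ball] at hz
    rw [Seminorm.mem_ball_zero]
    have h2 := map_add_le_add p (z - v) v
    rw [sub_add_cancel] at h2
    linarith [hs v hv]
  have key := measure_mono (μ := μ) hsub
  rw [measure_biUnion_finset hdisj fun v _ => (hopen v _).measurableSet,
    hscale 0 (by positivity)] at key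
  simp only [hscale _ (half_pos hε), Finset.sum_const, nsmul_eq_mul, ← mul_assoc] at key
  have key2 := (ENNReal.mul_le_mul_iff_left hpos hfin).1 key
  have key3 := ENNReal.toReal_le_of_le_ofReal (by positivity) key2
  rw [ENNReal.toReal_mul, ENNReal.toReal_natCast, ENNReal.toReal_ofReal (by positivity)] at key3
  rw [← le_div_iff₀ (by positivity), ← div_pow] at key3
  have hquot : (1 + ε / 2) / (ε / 2) = 1 + 2 / ε := by
    field_simp
    ring
  rwa [hquot] at key3

open Module in
/-- A subset of the unit ball has an `ε`-net whose size is at most `(1 + 2 / ε) ^ dim`. -/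
lemma Seminorm.exists_net {E : Type*} [NormedAddCommGroup E] [NormedSpace ℝ E]
    [FiniteDimensional ℝ E] (p : Seminorm ℝ E) (hp : Continuous p) {C : ℝ}
    (hC : ∀ x, ‖x‖ ≤ C * p x) {ε : ℝ} (hε : 0 < ε) :
    ∃ s : Finset E, (s.card : ℝ) ≤ (1 + 2 / ε) ^ finrank ℝ E ∧
      ∀ w, p w ≤ 1 → ∃ v ∈ s, p (w - v) < ε := by
  classical
  let S : Set (Finset E) := {s | (∀ v ∈ s, p v ≤ 1) ∧
    ∀ v ∈ s, ∀ w ∈ s, v ≠ w → ε ≤ p (v - w)}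
  have hcard (s : Finset E) (hs : s ∈ S) : (s.card : ℝ) ≤ (1 + 2 / ε) ^ finrank ℝ E :=
    p.card_le_of_separated hp hC hε s hs.1 hs.2
  have hfin : (Finset.card '' S).Finite := by
    refine (Set.finite_Iic ⌊(1 + 2 / ε) ^ finrank ℝ E⌋₊).subset ?_
    rintro _ ⟨s, hs, rfl⟩
    exact Nat.le_floor (hcard s hs)
  obtain ⟨s, hs, hmax⟩ := Set.Finite.exists_maximalFor' Finset.card S hfin ⟨∅, by simp [S]⟩
  refine ⟨s, hcard s hs, fun w hw => ?_⟩
  by_contra! hfar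
  have hws : w ∉ s := fun h => absurd (hfar w h) (by simpa using hε)
  have hmem : insert w s ∈ S := by
    refine ⟨fun v hv => ?_, fun v hv u hu hvu => ?_⟩
    · rcases Finset.mem_insert.1 hv with rfl | hv
      · exact hw
      · exact hs.1 v hv
    · rcases Finset.mem_insert.1 hv with rfl | hv' <;>
        rcases Finset.mem_insert.1 hu with rfl | hu'
      · exact absurd rfl hvu
      · exact hfar u hu'
      · rw [map_sub_rev]
        exact hfar v hv'
      · exact hs.2 v hv' u hu' hvu
  have hle : s.card ≤ (insert w s).card := Finset.card_le_card (Finset.subset_insert w s)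
  have := hmax hmem hle
  rw [Finset.card_insert_of_notMem hws] at this
  omega

/-- Expected loss on label `y` when predicting `+1` with probability `q`. -/
noncomputable def mistakeProb (q y : ℝ) : ℝ := (1 - y * (2 * q - 1)) / 2

lemma mistakeProb_mem_Icc {q y : ℝ} (hq : q ∈ Set.Icc (0 : ℝ) 1) (hy : y = 1 ∨ y = -1) :
    mistakeProb q y ∈ Set.Icc (0 : ℝ) 1 := by
  obtain ⟨h0, h1⟩ := hq
  rcases hy with rfl | rfl <;> constructor <;> unfold mistakeProb <;> linarith

/-- The exponential weights learner with experts `f` and step sizes `a / √(t + 1)`. -/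
noncomputable def hedge {X ι : Type*} [Fintype ι] (f : ι → X → ℝ) (a : ℝ)
    (hist : List (X × ℝ)) (x : X) : ℝ :=
  (∑ i, Real.exp (-(a / Real.sqrt (hist.length + 1) *
      (hist.map fun p => mistakeProb (f i p.1) p.2).sum)) * f i x) /
    ∑ i, Real.exp (-(a / Real.sqrt (hist.length + 1) *
      (hist.map fun p => mistakeProb (f i p.1) p.2).sum))

lemma hedge_mem_Icc {X ι : Type*} [Fintype ι] (f : ι → X → ℝ)
    (hf : ∀ i x, f i x ∈ Set.Icc (0 : ℝ) 1) (a : ℝ) (hist : List (X × ℝ)) (x : X) :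
    hedge f a hist x ∈ Set.Icc (0 : ℝ) 1 := by
  constructor
  · exact div_nonneg (Finset.sum_nonneg fun i _ => mul_nonneg (Real.exp_pos _).le (hf i x).1)
      (Finset.sum_nonneg fun i _ => (Real.exp_pos _).le)
  · exact div_le_one_of_le₀
      (Finset.sum_le_sum fun i _ => mul_le_of_le_one_right (Real.exp_pos _).le (hf i x).2)
      (Finset.sum_nonneg fun i _ => (Real.exp_pos _).le)

lemma mistakeProb_weighted_mean {ι : Type*} [Fintype ι] (W q : ι → ℝ) (hW : ∑ i, W i ≠ 0)
    (y : ℝ) :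
    mistakeProb ((∑ i, W i * q i) / ∑ i, W i) y =
      (∑ i, W i * mistakeProb (q i) y) / ∑ i, W i := by
  have h1 : ∑ i, W i * mistakeProb (q i) y =
      (1 + y) / 2 * ∑ i, W i - y * ∑ i, W i * q i := by
    rw [Finset.mul_sum, Finset.mul_sum, ← Finset.sum_sub_distrib]
    refine Finset.sum_congr rfl fun i _ => ?_
    unfold mistakeProb
    ring
  rw [h1, mistakeProb]
  field_simp
  ring

lemma expMistakes_hedge_le {X ι : Type*} [Fintype ι] [Nonempty ι] (f : ι → X → ℝ)
    (hf : ∀ i x, f i x ∈ Set.Icc (0 : ℝ) 1) {a : ℝ} (ha : 0 < a)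
    (hcard : Real.log (Fintype.card ι) ≤ a ^ 2) (T : ℕ) (x : ℕ → X) (y : ℕ → ℝ)
    (hy : ∀ t, y t = 1 ∨ y t = -1) (j : ι) :
    expMistakes (hedge f a) T x y ≤
      ∑ t ∈ Finset.range T, mistakeProb (f j (x t)) (y t) + 4 * (a * Real.sqrt T) := by
  refine le_trans (le_of_eq ?_) (exp_weights_regret
    (fun t i => mistakeProb (f i (x t)) (y t))
    (fun t i => mistakeProb_mem_Icc (hf i (x t)) (hy t)) ha hcard T j)
  refine Finset.sum_congr rfl fun t _ => ?_
  rw [← mistakeProb_weighted_mean _ _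
    (Finset.sum_pos (fun i _ => Real.exp_pos _) Finset.univ_nonempty).ne']
  simp [mistakeProb, hedge, List.map_map, Function.comp_def, Finset.sum_range,
    ← List.sum_ofFn, List.ofFn_eq_map, ← List.map_coe_finRange_eq_range]

lemma expMistakes_le_horizon {X : Type*} (A : List (X × ℝ) → X → ℝ)
    (hA : ∀ hist x, A hist x ∈ Set.Icc (0 : ℝ) 1) (T : ℕ) (x : ℕ → X) (y : ℕ → ℝ)
    (hy : ∀ t, y t = 1 ∨ y t = -1) : expMistakes A T x y ≤ T := by
  refine (Finset.sum_le_card_nsmul _ _ 1 fun t _ => ?_).trans (by simp)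
  exact (mistakeProb_mem_Icc (hA _ _) (hy t)).2

/-- A dual norm, bundled as a seminorm. -/
noncomputable def dualSeminorm {E : Type*} [NormedAddCommGroup E] [InnerProductSpace ℝ E]
    (n nstar : E → ℝ) (h0 : n 0 = 0)
    (h : ∀ w, IsLUB {r : ℝ | ∃ x, n x ≤ 1 ∧ r = ⟪w, x⟫} (nstar w))
    (hneg : ∀ x, n (-x) = n x) : Seminorm ℝ E :=
  have hle (w x : E) (hx : n x ≤ 1) : ⟪w, x⟫ ≤ nstar w := (h w).1 ⟨x, hx, rfl⟩
  have hnn (w : E) : 0 ≤ nstar w := by simpa using hle w 0 (h0.trans_le zero_le_one)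
  Seminorm.ofSMulLE nstar
    (le_antisymm ((h 0).2 (by rintro _ ⟨x, -, rfl⟩; simp)) (hnn 0))
    (fun v w => (h _).2 (by
      rintro _ ⟨x, hx, rfl⟩
      rw [inner_add_left]
      exact add_le_add (hle v x hx) (hle w x hx)))
    (fun a w => (h _).2 (by
      rintro _ ⟨x, hx, rfl⟩
      rw [real_inner_smul_left, Real.norm_eq_abs]
      rcases le_total 0 a with ha | ha
      · rw [abs_of_nonneg ha]
        exact mul_le_mul_of_nonneg_left (hle w x hx) ha
      · rw [abs_of_nonpos ha]
        have := hle w (-x) ((hneg x).trans_le hx)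
        rw [inner_neg_right] at this
        nlinarith))

lemma Seminorm.continuous_of_finiteDimensional {E : Type*} [NormedAddCommGroup E]
    [NormedSpace ℝ E] [FiniteDimensional ℝ E] (p : Seminorm ℝ E) : Continuous p := by
  rw [← continuousOn_univ]
  exact p.convexOn.continuousOn isOpen_univ

/-- agnostic online learning of halfspaces with margin `γ` for an
arbitrary norm `n` on `ℝ^d` (with dual norm `nstar`), with regret
`c·√(T · d · ln(1 + 2B/γ))` against the best unit-dual-norm halfspace. -/
theorem stmt6 :
    ∃ c : ℝ, 0 < c ∧
      ∀ (d : ℕ) (n nstar : EuclideanSpace ℝ (Fin d) → ℝ),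
        -- `n` is a norm on ℝ^d
        (∀ x, 0 ≤ n x) → (∀ x, n x = 0 ↔ x = 0) →
        (∀ (a : ℝ) (x), n (a • x) = |a| * n x) →
        (∀ x z, n (x + z) ≤ n x + n z) →
        -- `nstar` is its dual norm: `nstar w = sup { ⟪w,x⟫ : n x ≤ 1 }`
        (∀ w, IsLUB {r : ℝ | ∃ x, n x ≤ 1 ∧ r = ⟪w, x⟫} (nstar w)) →
      ∀ (X : Set (EuclideanSpace ℝ (Fin d))) (B γ : ℝ), 0 < γ →
        IsLUB (n '' X) B →
      ∃ A : List (EuclideanSpace ℝ (Fin d) × ℝ) → EuclideanSpace ℝ (Fin d) → ℝ,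
        (∀ hist x, A hist x ∈ Set.Icc (0:ℝ) 1) ∧
        ∀ (T : ℕ) (x : ℕ → EuclideanSpace ℝ (Fin d)) (y : ℕ → ℝ),
          (∀ t, x t ∈ X) → (∀ t, y t = 1 ∨ y t = -1) →
        ∀ w : EuclideanSpace ℝ (Fin d), nstar w = 1 →
          expMistakes A T x y
              - ∑ t ∈ Finset.range T, ind (y t * ⟪w, x t⟫ ≤ γ)
            ≤ c * Real.sqrt (T * d * Real.log (1 + 2 * B / γ)) := by
  refine ⟨4, by norm_num, ?_⟩
  intro d n nstar hn0 hneq hnsmul hnadd hstar X B γ hγ hB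
  have hnz : n 0 = 0 := (hneq 0).2 rfl
  have hnneg (x) : n (-x) = n x := by simpa using hnsmul (-1) x
  set p := dualSeminorm n nstar hnz hstar hnneg
  have hp (w) : p w = nstar w := rfl
  have hinner (w x : EuclideanSpace ℝ (Fin d)) : ⟪w, x⟫ ≤ p w * n x := by
    rcases (hn0 x).eq_or_lt with hx | hx
    · simp [(hneq x).1 hx.symm, hnz]
    · have h1 := (hstar w).1 ⟨(n x)⁻¹ • x, by
        rw [hnsmul, abs_of_pos (inv_pos.2 hx), inv_mul_cancel₀ hx.ne'], rfl⟩
      rw [real_inner_smul_right, inv_mul_le_iff₀ hx] at h1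
      rw [hp]
      linarith
  have hinner' (w x : EuclideanSpace ℝ (Fin d)) : |⟪w, x⟫| ≤ p w * n x := by
    refine abs_le'.2 ⟨hinner w x, ?_⟩
    simpa [hnneg] using hinner w (-x)
  have hXB (x) (hx : x ∈ X) : n x ≤ B := hB.1 ⟨x, hx, rfl⟩
  have hymul (y r : ℝ) (hy : y = 1 ∨ y = -1) : y * r ≤ |r| := by
    rcases hy with rfl | rfl
    · simpa using le_abs_self r
    · simpa using neg_le_abs r
  rcases le_or_gt B γ with hBγ | hBγ
  · refine ⟨fun _ _ => 0, fun _ _ => by simp, fun T x y hx hy w hw => ?_⟩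
    have h1 := expMistakes_le_horizon (fun _ _ => (0 : ℝ)) (fun _ _ => by simp) T x y hy
    have h2 : ∑ t ∈ Finset.range T, ind (y t * ⟪w, x t⟫ ≤ γ) = T := by
      have hone (t : ℕ) : ind (y t * ⟪w, x t⟫ ≤ γ) = 1 := by
        have h3 := hinner' w (x t)
        rw [hp, hw, one_mul] at h3
        exact if_pos ((hymul _ _ (hy t)).trans (h3.trans ((hXB _ (hx t)).trans hBγ)))
      simp [hone]
    rw [h2]
    exact (sub_nonpos.2 h1).trans (by positivity)
  rcases Nat.eq_zero_or_pos d with rfl | hd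
  · refine ⟨fun _ _ => 0, fun _ _ => by simp, fun T x y hx hy w hw => ?_⟩
    rw [Subsingleton.elim w 0, ← hp, map_zero] at hw
    exact absurd hw zero_ne_one
  have hBpos : 0 < B := hγ.trans hBγ
  let N : Seminorm ℝ (EuclideanSpace ℝ (Fin d)) := Seminorm.of n hnadd hnsmul
  obtain ⟨C, -, hC⟩ :=
    Seminorm.bound_of_continuous_normedSpace N N.continuous_of_finiteDimensional
  have hlower (w : EuclideanSpace ℝ (Fin d)) : ‖w‖ ≤ C * p w := by
    rcases (norm_nonneg w).eq_or_lt with h | h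
    · simp [norm_eq_zero.1 h.symm]
    · have h1 := hinner w w
      rw [real_inner_self_eq_norm_mul_norm] at h1
      have h2 := mul_le_mul_of_nonneg_left (hC w) (apply_nonneg p w)
      have h3 : p w * n w ≤ p w * (C * ‖w‖) := h2
      refine le_of_mul_le_mul_right ?_ h
      linarith
  obtain ⟨s, hscard, hs⟩ := p.exists_net p.continuous_of_finiteDimensional hlower
    (div_pos hγ hBpos)
  obtain ⟨v₀, hv₀, -⟩ := hs 0 (by simp)
  have : Nonempty s := ⟨⟨v₀, hv₀⟩⟩
  have hratio : 2 / (γ / B) = 2 * B / γ := by field_simp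
  rw [finrank_euclideanSpace_fin, hratio] at hscard
  have hlog : 0 < Real.log (1 + 2 * B / γ) := Real.log_pos (by
    have : 0 < 2 * B / γ := by positivity
    linarith)
  have hD : 0 < d * Real.log (1 + 2 * B / γ) := mul_pos (by exact_mod_cast hd) hlog
  let f : s → EuclideanSpace ℝ (Fin d) → ℝ := fun v x =>
    ind (0 < ⟪(v : EuclideanSpace ℝ (Fin d)), x⟫)
  have hf (v x) : f v x ∈ Set.Icc (0 : ℝ) 1 := by
    simp only [f, ind]
    split_ifs <;> simp
  refine ⟨hedge f (Real.sqrt (d * Real.log (1 + 2 * B / γ))), hedge_mem_Icc f hf _,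
    fun T x y hx hy w hw => ?_⟩
  obtain ⟨v, hv, hvw⟩ := hs w hw.le
  have hregret := expMistakes_hedge_le f hf (Real.sqrt_pos.2 hD) (by
    rw [Real.sq_sqrt hD.le, Fintype.card_coe, ← Real.log_pow]
    exact Real.log_le_log (by exact_mod_cast Finset.card_pos.2 ⟨v, hv⟩) hscard)
    T x y hy ⟨v, hv⟩
  have hexpert : ∑ t ∈ Finset.range T, mistakeProb (f ⟨v, hv⟩ (x t)) (y t) ≤
      ∑ t ∈ Finset.range T, ind (y t * ⟪w, x t⟫ ≤ γ) := by
    refine Finset.sum_le_sum fun t _ => ?_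
    by_cases hm : y t * ⟪w, x t⟫ ≤ γ
    · rw [ind, if_pos hm]
      exact (mistakeProb_mem_Icc (hf _ _) (hy t)).2
    · rw [ind, if_neg hm]
      have h1 := (hymul (y t) _ (hy t)).trans (hinner' (w - v) (x t))
      have h2 : p (w - v) * n (x t) ≤ γ := by
        calc p (w - v) * n (x t) ≤ γ / B * B :=
              mul_le_mul hvw.le (hXB _ (hx t)) (hn0 _) (by positivity)
          _ = γ := by field_simp
      rw [inner_sub_left, mul_sub] at h1
      have h3 : 0 < y t * ⟪v, x t⟫ := by linarith
      rcases hy t with h | h <;> rw [h] at h3 ⊢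
      · have h4 : 0 < ⟪v, x t⟫ := by linarith
        simp [mistakeProb, f, ind, h4]
        norm_num
      · have h4 : ¬ 0 < ⟪v, x t⟫ := by linarith
        simp [mistakeProb, f, ind, h4]
  have hsqrt : Real.sqrt (T * d * Real.log (1 + 2 * B / γ)) =
      Real.sqrt (d * Real.log (1 + 2 * B / γ)) * Real.sqrt T := by
    rw [← Real.sqrt_mul hD.le]
    congr 1
    ring
  rw [hsqrt]
  linarith
end

section
/- Let f : ℝ^n → [−1,1] be measurable, let σ > 0, and define the σ-smoothed function f̂_σ(x) = ∫_{ℝ^n} f(t)·φ_σ(x − t) dt, where φ_σ(z) = (2πσ²)^{−n/2}·exp(−‖z‖₂²/(2σ²)) is the density of N(0, σ²I_n). Then f̂_σ is differentiable and ‖∇f̂_σ(x)‖₂ ≤ √(2/π)/σ for every x ∈ ℝ^n; in particular f̂_σ is (√(2/π)/σ)-Lipschitz with respect to the Euclidean norm. -/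
open MeasureTheory

section GaussianSmoothing

theorem integral_abs_mul_exp_neg_mul_sq {b : ℝ} (hb : 0 < b) :
    ∫ x : ℝ, |x| * Real.exp (-b * x ^ 2) = b⁻¹ := by
  have h := integral_comp_abs (f := fun x : ℝ => x * Real.exp (-b * x ^ 2))
  simp only [sq_abs] at h
  rw [h]
  have h2 : ((∫ x in Set.Ioi (0 : ℝ), x * Real.exp (-b * x ^ 2) : ℝ) : ℂ) = (2 * (b : ℂ))⁻¹ := by
    rw [← integral_mul_cexp_neg_mul_sq (b := (b : ℂ)) (by simpa using hb),
      ← integral_complex_ofReal]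
    congr 1
    ext x
    push_cast
    rfl
  have h3 : (∫ x in Set.Ioi (0 : ℝ), x * Real.exp (-b * x ^ 2)) = (2 * b)⁻¹ := by
    exact_mod_cast h2
  rw [h3]
  field_simp

theorem integral_abs_coord_mul_exp_neg_mul_sq_norm {n : ℕ} {b : ℝ} (hb : 0 < b) (i₀ : Fin n) :
    ∫ y : EuclideanSpace ℝ (Fin n), |y i₀| * Real.exp (-b * ‖y‖ ^ 2) =
      b⁻¹ * √(Real.pi / b) ^ (n - 1) := by
  rw [← (PiLp.volume_preserving_toLp (Fin n)).integral_comp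
    (MeasurableEquiv.toLp 2 _).measurableEmbedding]
  have h : ∀ y : Fin n → ℝ,
      |(WithLp.toLp 2 y : EuclideanSpace ℝ (Fin n)) i₀| *
          Real.exp (-b * ‖(WithLp.toLp 2 y : EuclideanSpace ℝ (Fin n))‖ ^ 2) =
        ∏ i, (if i = i₀ then |y i| else 1) * Real.exp (-b * y i ^ 2) := by
    intro y
    rw [Finset.prod_mul_distrib, ← Real.exp_sum, ← Finset.mul_sum, EuclideanSpace.real_norm_sq_eq]
    simp
  simp_rw [h]
  rw [integral_fintype_prod_volume_eq_prod
    (f := fun i (x : ℝ) => (if i = i₀ then |x| else 1) * Real.exp (-b * x ^ 2)),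
    ← Finset.mul_prod_erase _ _ (Finset.mem_univ i₀)]
  simp only [if_true]
  rw [integral_abs_mul_exp_neg_mul_sq hb, Finset.prod_congr rfl (g := fun _ => √(Real.pi / b))]
  · simp
  · intro i hi
    simp only [Finset.ne_of_mem_erase hi, if_false, one_mul, integral_gaussian]

theorem integral_abs_inner_mul_exp_neg_mul_sq_norm {n : ℕ} {b : ℝ} (hb : 0 < b)
    (u : EuclideanSpace ℝ (Fin n)) (hu : ‖u‖ = 1) :
    ∫ z : EuclideanSpace ℝ (Fin n), |inner ℝ u z| * Real.exp (-b * ‖z‖ ^ 2) =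
      b⁻¹ * √(Real.pi / b) ^ (n - 1) := by
  obtain ⟨i₀⟩ : Nonempty (Fin n) := by
    by_contra h
    rw [not_nonempty_iff] at h
    simp [Subsingleton.elim u 0] at hu
  obtain ⟨e, he⟩ := Orthonormal.exists_orthonormalBasis_extension_of_card_eq (𝕜 := ℝ)
    (E := EuclideanSpace ℝ (Fin n)) (ι := Fin n) (by simp) (v := fun _ => u) (s := {i₀})
    ⟨fun _ => hu, fun i j hij => (hij (Subsingleton.elim i j)).elim⟩
  have he := he i₀ rfl
  rw [← integral_abs_coord_mul_exp_neg_mul_sq_norm hb i₀,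
    ← e.measurePreserving_repr_symm.integral_comp
      e.repr.symm.toHomeomorph.measurableEmbedding]
  congr 1
  ext y
  rw [← he, ← e.repr_apply_apply]
  simp

theorem integrable_exp_neg_mul_sq_norm {n : ℕ} {b : ℝ} (hb : 0 < b) :
    Integrable fun z : EuclideanSpace ℝ (Fin n) => Real.exp (-b * ‖z‖ ^ 2) := by
  have h := (GaussianFourier.integrable_cexp_neg_mul_sq_norm_add
    (V := EuclideanSpace ℝ (Fin n)) (b := (b : ℂ)) (by simpa using hb) 0 0).norm
  refine h.congr (Filter.Eventually.of_forall fun z => ?_)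
  simp only [Complex.norm_exp]
  norm_cast
  simp

theorem mul_exp_neg_mul_sq_norm_le {E : Type*} [NormedAddCommGroup E] {b : ℝ} (hb : 0 < b)
    {z w : E} (hzw : ‖w - z‖ ≤ 1) :
    ‖z‖ * Real.exp (-b * ‖z‖ ^ 2) ≤
      (1 + 1 / (2 * b)) * Real.exp (b / 2) * Real.exp (-(b / 4) * ‖w‖ ^ 2) := by
  have h1 : ‖z‖ ≤ (1 + 1 / (2 * b)) * Real.exp (b / 2 * ‖z‖ ^ 2) := by
    have h2 := Real.add_one_le_exp (b / 2 * ‖z‖ ^ 2)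
    have h3 : ‖z‖ ≤ 1 / (2 * b) + b / 2 * ‖z‖ ^ 2 := by
      have : 1 / (2 * b) + b / 2 * ‖z‖ ^ 2 - ‖z‖ = (b * ‖z‖ - 1) ^ 2 / (2 * b) := by
        field_simp
        ring
      have : 0 ≤ (b * ‖z‖ - 1) ^ 2 / (2 * b) := by positivity
      linarith
    have h4 : 0 ≤ b / 2 * ‖z‖ ^ 2 := by positivity
    have h5 : 0 < 1 / (2 * b) := by positivity
    nlinarith
  have h6 : ‖w‖ ^ 2 ≤ 2 * ‖z‖ ^ 2 + 2 := by
    have : ‖w‖ ≤ ‖z‖ + 1 := by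
      have := norm_sub_norm_le w z
      linarith
    nlinarith [norm_nonneg w, norm_nonneg z, sq_nonneg (‖z‖ - 1)]
  calc ‖z‖ * Real.exp (-b * ‖z‖ ^ 2)
      ≤ (1 + 1 / (2 * b)) * Real.exp (b / 2 * ‖z‖ ^ 2) * Real.exp (-b * ‖z‖ ^ 2) := by gcongr
    _ = (1 + 1 / (2 * b)) * Real.exp (-(b / 2) * ‖z‖ ^ 2) := by
        rw [mul_assoc, ← Real.exp_add]
        ring_nf
    _ ≤ (1 + 1 / (2 * b)) * Real.exp (b / 2 + -(b / 4) * ‖w‖ ^ 2) := by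
        gcongr
        nlinarith
    _ = _ := by rw [Real.exp_add, mul_assoc]

theorem hasFDerivAt_exp_neg_mul_sq_norm {E : Type*} [NormedAddCommGroup E]
    [InnerProductSpace ℝ E] (b : ℝ) (z : E) :
    HasFDerivAt (fun z : E => Real.exp (-b * ‖z‖ ^ 2))
      ((-(2 * b) * Real.exp (-b * ‖z‖ ^ 2)) • innerSL ℝ z) z := by
  have h := (((hasStrictFDerivAt_norm_sq z).hasFDerivAt).const_mul (-b)).exp
  convert h using 1
  ext v
  simp
  ring

theorem integrable_norm_mul_exp_neg_mul_sq_norm {n : ℕ} {b : ℝ} (hb : 0 < b) :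
    Integrable fun z : EuclideanSpace ℝ (Fin n) => ‖z‖ * Real.exp (-b * ‖z‖ ^ 2) := by
  refine ((integrable_exp_neg_mul_sq_norm (n := n) (b := b / 4) (by positivity)).const_mul
    ((1 + 1 / (2 * b)) * Real.exp (b / 2))).mono'
    (Continuous.aestronglyMeasurable (by fun_prop)) (Filter.Eventually.of_forall fun z => ?_)
  rw [Real.norm_of_nonneg (by positivity)]
  exact mul_exp_neg_mul_sq_norm_le hb (by simp)

theorem hasFDerivAt_integral_mul_exp_neg_mul_sq_norm {n : ℕ} {f : EuclideanSpace ℝ (Fin n) → ℝ}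
    (hf : Measurable f) (hbd : ∀ t, |f t| ≤ 1) {b : ℝ} (hb : 0 < b)
    (x : EuclideanSpace ℝ (Fin n)) :
    HasFDerivAt (fun x => ∫ t, f t * Real.exp (-b * ‖x - t‖ ^ 2))
      (∫ t, (f t * (-(2 * b) * Real.exp (-b * ‖x - t‖ ^ 2))) • innerSL ℝ (x - t)) x := by
  have hmeas : ∀ y, AEStronglyMeasurable
      (fun t : EuclideanSpace ℝ (Fin n) => f t * Real.exp (-b * ‖y - t‖ ^ 2)) volume := fun y =>
    hf.aestronglyMeasurable.mul (Continuous.aestronglyMeasurable (by fun_prop))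
  refine hasFDerivAt_integral_of_dominated_of_fderiv_le (𝕜 := ℝ) (μ := volume)
    (F := fun x t => f t * Real.exp (-b * ‖x - t‖ ^ 2))
    (F' := fun x t => (f t * (-(2 * b) * Real.exp (-b * ‖x - t‖ ^ 2))) • innerSL ℝ (x - t))
    (bound := fun t => 2 * b * ((1 + 1 / (2 * b)) * Real.exp (b / 2) *
      Real.exp (-(b / 4) * ‖x - t‖ ^ 2)))
    (Metric.ball_mem_nhds x one_pos) (Filter.Eventually.of_forall hmeas) ?_ ?_ ?_ ?_ ?_
  · refine ((integrable_exp_neg_mul_sq_norm hb).comp_sub_left x).mono' (hmeas x)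
      (Filter.Eventually.of_forall fun t => ?_)
    rw [norm_mul, Real.norm_eq_abs, Real.norm_of_nonneg (Real.exp_nonneg _)]
    exact mul_le_of_le_one_left (Real.exp_nonneg _) (hbd t)
  · exact (hf.aestronglyMeasurable.mul (Continuous.aestronglyMeasurable (by fun_prop))).smul
      (Continuous.aestronglyMeasurable (by fun_prop))
  · refine Filter.Eventually.of_forall fun t y hy => ?_
    have h := mul_exp_neg_mul_sq_norm_le hb (z := y - t) (w := x - t) (by
      rw [sub_sub_sub_cancel_right, ← dist_eq_norm, dist_comm]
      exact (Metric.mem_ball.1 hy).le)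
    rw [norm_smul, innerSL_apply_norm, norm_mul, norm_mul, norm_neg,
      Real.norm_of_nonneg (by positivity : 0 ≤ 2 * b), Real.norm_of_nonneg (Real.exp_nonneg _),
      Real.norm_eq_abs]
    calc |f t| * (2 * b * Real.exp (-b * ‖y - t‖ ^ 2)) * ‖y - t‖
        ≤ 1 * (2 * b * Real.exp (-b * ‖y - t‖ ^ 2)) * ‖y - t‖ := by
          gcongr
          exact hbd t
      _ = 2 * b * (‖y - t‖ * Real.exp (-b * ‖y - t‖ ^ 2)) := by ring
      _ ≤ _ := by gcongr
  · exact (((integrable_exp_neg_mul_sq_norm (by positivity)).comp_sub_left x).const_mul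
      _).const_mul _
  · refine Filter.Eventually.of_forall fun t y _ => ?_
    have h := ((hasFDerivAt_exp_neg_mul_sq_norm b (y - t)).comp y
      ((hasFDerivAt_id y).sub_const t)).const_mul (f t)
    rw [ContinuousLinearMap.comp_id, smul_smul] at h
    exact h

theorem norm_integral_smul_innerSL_le {n : ℕ} {f : EuclideanSpace ℝ (Fin n) → ℝ}
    (hf : Measurable f) (hbd : ∀ t, |f t| ≤ 1) {b : ℝ} (hb : 0 < b)
    (x : EuclideanSpace ℝ (Fin n)) :
    ‖∫ t, (f t * (-(2 * b) * Real.exp (-b * ‖x - t‖ ^ 2))) • innerSL ℝ (x - t)‖ ≤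
      2 * √(Real.pi / b) ^ (n - 1) := by
  have hint : Integrable fun t : EuclideanSpace ℝ (Fin n) =>
      (f t * (-(2 * b) * Real.exp (-b * ‖x - t‖ ^ 2))) • innerSL ℝ (x - t) := by
    refine (((integrable_norm_mul_exp_neg_mul_sq_norm hb).comp_sub_left x).const_mul (2 * b)).mono'
      ((hf.aestronglyMeasurable.mul (Continuous.aestronglyMeasurable (by fun_prop))).smul
        (Continuous.aestronglyMeasurable (by fun_prop)))
      (Filter.Eventually.of_forall fun t => ?_)
    rw [norm_smul, innerSL_apply_norm, norm_mul, norm_mul, norm_neg,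
      Real.norm_of_nonneg (by positivity : 0 ≤ 2 * b), Real.norm_of_nonneg (Real.exp_nonneg _),
      Real.norm_eq_abs]
    calc |f t| * (2 * b * Real.exp (-b * ‖x - t‖ ^ 2)) * ‖x - t‖
        ≤ 1 * (2 * b * Real.exp (-b * ‖x - t‖ ^ 2)) * ‖x - t‖ := by
          gcongr
          exact hbd t
      _ = 2 * b * (‖x - t‖ * Real.exp (-b * ‖x - t‖ ^ 2)) := by ring
  refine ContinuousLinearMap.opNorm_le_of_unit_norm (by positivity) fun u hu => ?_
  rw [ContinuousLinearMap.integral_apply hint]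
  have hint' : Integrable fun z : EuclideanSpace ℝ (Fin n) =>
      |inner ℝ u z| * Real.exp (-b * ‖z‖ ^ 2) := by
    refine (integrable_norm_mul_exp_neg_mul_sq_norm hb).mono'
      (Continuous.aestronglyMeasurable (by fun_prop)) (Filter.Eventually.of_forall fun z => ?_)
    rw [Real.norm_of_nonneg (by positivity)]
    gcongr
    simpa [hu] using abs_real_inner_le_norm u z
  refine (norm_integral_le_of_norm_le ((hint'.comp_sub_left x).const_mul (2 * b))
    (Filter.Eventually.of_forall fun t => ?_)).trans_eq ?_
  · simp only [smul_apply, innerSL_apply_apply, smul_eq_mul]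
    rw [norm_mul, norm_mul, norm_mul, norm_neg, Real.norm_of_nonneg (by positivity : 0 ≤ 2 * b),
      Real.norm_of_nonneg (Real.exp_nonneg _), Real.norm_eq_abs, Real.norm_eq_abs,
      real_inner_comm]
    calc |f t| * (2 * b * Real.exp (-b * ‖x - t‖ ^ 2)) * |inner ℝ u (x - t)|
        ≤ 1 * (2 * b * Real.exp (-b * ‖x - t‖ ^ 2)) * |inner ℝ u (x - t)| := by
          gcongr
          exact hbd t
      _ = 2 * b * (|inner ℝ u (x - t)| * Real.exp (-b * ‖x - t‖ ^ 2)) := by ring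
  · rw [integral_const_mul, integral_sub_left_eq_self
      (fun z => |inner ℝ u z| * Real.exp (-b * ‖z‖ ^ 2)) volume x,
      integral_abs_inner_mul_exp_neg_mul_sq_norm hb u hu]
    field_simp

theorem gaussian_normalization_mul_eq {σ : ℝ} (hσ : 0 < σ) (n : ℕ) (hn : n ≠ 0) :
    (2 * Real.pi * σ ^ 2) ^ (-(n : ℝ) / 2) *
      (2 * √(Real.pi / (1 / (2 * σ ^ 2))) ^ (n - 1)) = √(2 / Real.pi) / σ := by
  obtain ⟨m, rfl⟩ := Nat.exists_eq_succ_of_ne_zero hn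
  have hpi := Real.pi_pos
  have hs : Real.pi / (1 / (2 * σ ^ 2)) = 2 * Real.pi * σ ^ 2 := by field_simp
  have hpos : 0 < 2 * Real.pi * σ ^ 2 := by positivity
  have hr : (2 * Real.pi * σ ^ 2) ^ (-((m.succ : ℕ) : ℝ) / 2) =
      (√(2 * Real.pi * σ ^ 2) ^ (m + 1))⁻¹ := by
    rw [neg_div, Real.rpow_neg hpos.le, Real.sqrt_eq_rpow, ← Real.rpow_mul_natCast hpos.le]
    congr 2
    push_cast
    ring
  rw [hs, hr, Nat.succ_sub_one, pow_succ]
  have h1 : √(2 * Real.pi * σ ^ 2) = √(2 * Real.pi) * σ := by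
    rw [Real.sqrt_mul (by positivity), Real.sqrt_sq hσ.le]
  have h2 : √(2 / Real.pi) * √(2 * Real.pi) = 2 := by
    rw [← Real.sqrt_mul (by positivity),
      show 2 / Real.pi * (2 * Real.pi) = 2 ^ 2 by field_simp, Real.sqrt_sq (by norm_num)]
  have h3 : 0 < √(2 * Real.pi) := by positivity
  have h4 : 0 < √(2 * Real.pi * σ ^ 2) := by positivity
  rw [show √(2 / Real.pi) = 2 / √(2 * Real.pi) from (eq_div_iff h3.ne').2 h2]
  rw [mul_inv]
  nth_rewrite 2 [h1]
  field_simp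

end GaussianSmoothing



/-- Gaussian smoothing of a bounded measurable `f : ℝⁿ → [-1,1]` yields a
differentiable function whose gradient is uniformly bounded by `√(2/π)/σ`; in particular
the smoothed function is `√(2/π)/σ`-Lipschitz. -/
theorem stmt10 (n : ℕ) (f : EuclideanSpace ℝ (Fin n) → ℝ) (hf : Measurable f)
    (hbd : ∀ t, f t ∈ Set.Icc (-1:ℝ) 1) (σ : ℝ) (hσ : 0 < σ)
    (φσ : EuclideanSpace ℝ (Fin n) → ℝ)
    (hφσ : ∀ z, φσ z =
      (2 * Real.pi * σ ^ 2) ^ (-(n : ℝ) / 2) * Real.exp (-‖z‖ ^ 2 / (2 * σ ^ 2)))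
    (fhat : EuclideanSpace ℝ (Fin n) → ℝ)
    (hfhat : ∀ x, fhat x = ∫ t, f t * φσ (x - t)) :
    Differentiable ℝ fhat ∧
    (∀ x, ‖gradient fhat x‖ ≤ Real.sqrt (2 / Real.pi) / σ) ∧
    LipschitzWith (Real.toNNReal (Real.sqrt (2 / Real.pi) / σ)) fhat := by
  have hbd' : ∀ t, |f t| ≤ 1 := fun t => abs_le.2 (hbd t)
  have hb : 0 < 1 / (2 * σ ^ 2) := by positivity
  have hc : 0 < (2 * Real.pi * σ ^ 2) ^ (-(n : ℝ) / 2) := by positivity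
  set c := (2 * Real.pi * σ ^ 2) ^ (-(n : ℝ) / 2)
  set b := 1 / (2 * σ ^ 2) with hbdef
  have hfhat' : fhat = fun x => c * ∫ t, f t * Real.exp (-b * ‖x - t‖ ^ 2) := by
    ext x
    rw [hfhat, ← integral_const_mul]
    congr 1
    ext t
    rw [hφσ, show -‖x - t‖ ^ 2 / (2 * σ ^ 2) = -b * ‖x - t‖ ^ 2 by rw [hbdef]; ring]
    ring
  have hderiv := fun x =>
    (hasFDerivAt_integral_mul_exp_neg_mul_sq_norm hf hbd' hb x).const_mul c
  rw [← hfhat'] at hderiv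
  have hdiff : Differentiable ℝ fhat := fun x => (hderiv x).differentiableAt
  have hnorm : ∀ x, ‖fderiv ℝ fhat x‖ ≤ √(2 / Real.pi) / σ := by
    intro x
    rcases eq_or_ne n 0 with rfl | hn
    · rw [Subsingleton.elim (fderiv ℝ fhat x) 0, norm_zero]
      positivity
    · rw [(hderiv x).fderiv, norm_smul, Real.norm_of_nonneg hc.le,
        ← gaussian_normalization_mul_eq hσ n hn]
      gcongr
      exact norm_integral_smul_innerSL_le hf hbd' hb x
  refine ⟨hdiff, fun x => ?_, lipschitzWith_of_nnnorm_fderiv_le hdiff fun x => ?_⟩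
  · rw [gradient, LinearIsometryEquiv.norm_map]
    exact hnorm x
  · rw [← NNReal.coe_le_coe, coe_nnnorm]
    exact (hnorm x).trans (Real.le_coe_toNNReal _)
end
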